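/- Let {𝓗,Γ₀,Γ₁} be a unitary boundary triple for A* with γ-field γ and Weyl function M, and assume that A₀ = ker Γ₀ is essentially selfadjoint (so γ(λ) is closable with λ-independent closure domain). Then: (1) there exists G ∈ 𝓑(𝓗) with ker G = {0} and ran G = dom(clos γ(λ)) (λ ∈ ℂ∖ℝ) such that the closure Γ̃ (in (𝔥×𝔥)×(𝓗×𝓗)) of the relation {(f̂, (u, G*Γ₁f̂)) : f̂ ∈ dom Γ, u ∈ 𝓗, Gu = Γ₀f̂} is an AB-generalized boundary pair for A*; (2) the Weyl function M̃ of Γ̃ is domain invariant and has the form M̃(λ) = E + M₀(λ), where E is a closed densely defined symmetric operator in 𝓗 and M₀(λ), defined on dom E, has closure belonging to R[𝓗]; (3) for every λ ∈ ℂ∖ℝ, the closure of the operator G*M(λ)G equals E₀ + M₀(λ) ⊆ M̃(λ), where E₀ ⊆ E is a closed densely defined symmetric restriction of E, and clos(G*M(λ)G) is itself the Weyl function of a closed AB-generalized boundary pair for A*. -/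

import Mathlib

noncomputable section

open Filter Topology

namespace BT

local notation "⟪" x ", " y "⟫" => @inner ℂ _ _ x y

section Ops
variable {α β γ' : Type*}

def domR (T : Set (α × β)) : Set α := {x | ∃ y, (x, y) ∈ T}
def ranR (T : Set (α × β)) : Set β := {y | ∃ x, (x, y) ∈ T}
def kerR [Zero β] (T : Set (α × β)) : Set α := {x | (x, (0 : β)) ∈ T}
def mulR [Zero α] (T : Set (α × β)) : Set β := {y | ((0 : α), y) ∈ T}
def invR (T : Set (α × β)) : Set (β × α) := {p | (p.2, p.1) ∈ T}
def compR (T₂ : Set (β × γ')) (T₁ : Set (α × β)) : Set (α × γ') :=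
  {p | ∃ y, (p.1, y) ∈ T₁ ∧ (y, p.2) ∈ T₂}
def csum [Add α] [Add β] (T₁ T₂ : Set (α × β)) : Set (α × β) :=
  {p | ∃ q ∈ T₁, ∃ r ∈ T₂, p = (q.1 + r.1, q.2 + r.2)}

def IsLinRel {M : Type*} [AddCommGroup M] [Module ℂ M] (s : Set M) : Prop :=
  ∃ p : Submodule ℂ M, (p : Set M) = s

def IsBddRel [Norm α] [Norm β] (T : Set (α × β)) : Prop :=
  ∃ C : ℝ, ∀ p ∈ T, ‖p.2‖ ≤ C * ‖p.1‖

def BddInv [NormedAddCommGroup α] (T : Set (α × α)) : Prop :=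
  (∀ v, ∃ p ∈ T, p.2 = v) ∧ (∀ p ∈ T, ∀ q ∈ T, p.2 = q.2 → p.1 = q.1) ∧
    ∃ C : ℝ, ∀ p ∈ T, ‖p.1‖ ≤ C * ‖p.2‖
end Ops

section Shifts
variable {α : Type*} [AddCommGroup α] [Module ℂ α]

def shiftSub (T : Set (α × α)) (l : ℂ) : Set (α × α) :=
  {p | ∃ q ∈ T, p = (q.1, q.2 - l • q.1)}
def shiftAdd (T : Set (α × α)) (l : ℂ) : Set (α × α) :=
  {p | ∃ q ∈ T, p = (q.1, q.2 + l • q.1)}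
def hatN (T : Set (α × α)) (l : ℂ) : Set (α × α) := {p ∈ T | p.2 = l • p.1}
def Nlam (T : Set (α × α)) (l : ℂ) : Set α := {f | (f, l • f) ∈ T}
def Hrel (A0s : Set (α × α)) (l : ℂ) : Set (α × (α × α)) :=
  {q | q.2 ∈ A0s ∧ q.2.2 - l • q.2.1 = q.1}
end Shifts

section InnerDefs
variable {E F : Type*} [NormedAddCommGroup E] [InnerProductSpace ℂ E]
  [NormedAddCommGroup F] [InnerProductSpace ℂ F]

def adjR (S : Set (F × E)) : Set (E × F) :=
  {p | ∀ q ∈ S, ⟪p.1, q.2⟫ = ⟪p.2, q.1⟫}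

def IsClosedSymRel (A : Set (E × E)) : Prop :=
  IsLinRel A ∧ IsClosed A ∧ A ⊆ adjR A

def kIP (p q : E × E) : ℂ := -Complex.I * ⟪q.1, p.2⟫ + Complex.I * ⟪q.2, p.1⟫

def kreinOrth (S : Set (E × E)) : Set (E × E) := {v | ∀ u ∈ S, kIP u v = 0}

def GreenPair (Γ : Set ((E × E) × (F × F))) : Prop :=
  ∀ p ∈ Γ, ∀ q ∈ Γ,
    ⟪q.1.1, p.1.2⟫ - ⟪q.1.2, p.1.1⟫ = ⟪q.2.1, p.2.2⟫ - ⟪q.2.2, p.2.1⟫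

def G0 (Γ : Set ((E × E) × (F × F))) : Set ((E × E) × F) := {p | ∃ h', (p.1, (p.2, h')) ∈ Γ}
def G1 (Γ : Set ((E × E) × (F × F))) : Set ((E × E) × F) := {p | ∃ h, (p.1, (h, p.2)) ∈ Γ}
def A0 (Γ : Set ((E × E) × (F × F))) : Set (E × E) := kerR (G0 Γ)
def A1 (Γ : Set ((E × E) × (F × F))) : Set (E × E) := kerR (G1 Γ)
def weyl (Γ : Set ((E × E) × (F × F))) (l : ℂ) : Set (F × F) :=
  {p | ∃ f : E, ((f, l • f), p) ∈ Γ}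
def gfield (Γ : Set ((E × E) × (F × F))) (l : ℂ) : Set (F × E) :=
  {p | ∃ h', ((p.2, l • p.2), (p.1, h')) ∈ Γ}

def kreinAdj (Γ : Set ((E × E) × (F × F))) : Set ((F × F) × (E × E)) :=
  {q | ∀ p ∈ Γ, kIP p.1 q.2 = kIP p.2 q.1}

def IsIsomPair (A : Set (E × E)) (Γ : Set ((E × E) × (F × F))) : Prop :=
  IsLinRel Γ ∧ domR Γ ⊆ adjR A ∧ GreenPair Γ
def IsDomDense (A : Set (E × E)) (Γ : Set ((E × E) × (F × F))) : Prop :=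
  closure (domR Γ) = adjR A
def IsABPair (A : Set (E × E)) (Γ : Set ((E × E) × (F × F))) : Prop :=
  IsIsomPair A Γ ∧ IsDomDense A Γ ∧ Dense (ranR (G0 Γ)) ∧ A0 Γ = adjR (A0 Γ)
def IsBPair (A : Set (E × E)) (Γ : Set ((E × E) × (F × F))) : Prop :=
  IsABPair A Γ ∧ ranR (G0 Γ) = Set.univ
def IsUnitaryPair (A : Set (E × E)) (Γ : Set ((E × E) × (F × F))) : Prop :=
  GreenPair Γ ∧ domR Γ ⊆ adjR A ∧ IsDomDense A Γ ∧ invR Γ = kreinAdj Γ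
def IsUnitaryBT (A : Set (E × E)) (Γ : Set ((E × E) × (F × F))) : Prop :=
  IsUnitaryPair A Γ ∧ mulR Γ = {0}
def IsOrdinaryBT (A : Set (E × E)) (Γ : Set ((E × E) × (F × F))) : Prop :=
  IsIsomPair A Γ ∧ mulR Γ = {0} ∧ domR Γ = adjR A ∧ ranR Γ = Set.univ

def Erel (Γ : Set ((E × E) × (F × F))) (m : ℂ) : Set (F × F) :=
  {p | ∃ u' v', (p.1, u') ∈ weyl Γ m ∧ (p.1, v') ∈ weyl Γ ((starRingEnd ℂ) m) ∧
        p.2 = (2 : ℂ)⁻¹ • (u' + v')}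

def triTransform (Γ : Set ((E × E) × (F × F))) (e : Set (F × F)) :
    Set ((E × E) × (F × F)) :=
  {q | ∃ h h' w, (q.1, (h, h')) ∈ Γ ∧ (h, w) ∈ e ∧ q.2 = (h, w + h')}

def formVal (l : ℂ) (u u' : F) : ℝ :=
  ((l - (starRingEnd ℂ) l)⁻¹ * (⟪u, u'⟫ - ⟪u', u⟫)).re

def FormClosable (l : ℂ) (Ms : Set (F × F)) : Prop :=
  ∀ u u' : ℕ → F, (∀ n, (u n, u' n) ∈ Ms) →
    Tendsto u atTop (nhds (0 : F)) →
    Tendsto (fun nm : ℕ × ℕ => formVal l (u nm.1 - u nm.2) (u' nm.1 - u' nm.2)) atTop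
      (nhds (0 : ℝ)) →
    Tendsto (fun n => formVal l (u n) (u' n)) atTop (nhds (0 : ℝ))

def formClosureDom (l : ℂ) (Ms : Set (F × F)) : Set F :=
  {v | ∃ u u' : ℕ → F, (∀ n, (u n, u' n) ∈ Ms) ∧ Tendsto u atTop (nhds v) ∧
    Tendsto (fun nm : ℕ × ℕ => formVal l (u nm.1 - u nm.2) (u' nm.1 - u' nm.2)) atTop
      (nhds (0 : ℝ))}

end InnerDefs

section CompleteDefs
variable {F : Type*} [NormedAddCommGroup F] [InnerProductSpace ℂ F] [CompleteSpace F]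

def IsNevFun (M₀ : ℂ → F →L[ℂ] F) : Prop :=
  DifferentiableOn ℂ M₀ {l : ℂ | l.im ≠ 0} ∧
  (∀ l : ℂ, l.im ≠ 0 → M₀ ((starRingEnd ℂ) l) = ContinuousLinearMap.adjoint (M₀ l)) ∧
  (∀ l : ℂ, 0 < l.im → ∀ u, 0 ≤ (⟪u, M₀ l u⟫).im)

def ImOp (Tb : F →L[ℂ] F) : F →L[ℂ] F :=
  ((2 : ℂ) * Complex.I)⁻¹ • (Tb - ContinuousLinearMap.adjoint Tb)

end CompleteDefs

variable {E F : Type*} [NormedAddCommGroup E] [InnerProductSpace ℂ E] [CompleteSpace E]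
  [NormedAddCommGroup F] [InnerProductSpace ℂ F] [CompleteSpace F]

/-- The renormalized boundary mapping `(G⁻¹Γ₀, G*Γ₁)` of a boundary triple. -/
def Gtrans (Γ : Set ((E × E) × (F × F))) (G : F →L[ℂ] F) : Set ((E × E) × (F × F)) :=
  {q | ∃ h' : F, (q.1, (G q.2.1, h')) ∈ Γ ∧ q.2.2 = ContinuousLinearMap.adjoint G h'}

/-- The renormalized Weyl function `G* M(l) G` (as a relation). -/
def GMG (Γ : Set ((E × E) × (F × F))) (G : F →L[ℂ] F) (l : ℂ) : Set (F × F) :=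
  {p | ∃ h' : F, (G p.1, h') ∈ weyl Γ l ∧ p.2 = ContinuousLinearMap.adjoint G h'}


section Generic

variable {H : Type*} [NormedAddCommGroup H] [InnerProductSpace ℂ H]

lemma adjR_lin {H K : Type*} [NormedAddCommGroup H] [InnerProductSpace ℂ H]
    [NormedAddCommGroup K] [InnerProductSpace ℂ K] (S : Set (K × H)) :
    ∃ p : Submodule ℂ (H × K), (p : Set (H × K)) = adjR S := by
  refine ⟨{ carrier := adjR S, add_mem' := ?_, zero_mem' := ?_, smul_mem' := ?_ }, rfl⟩
  · intro a b ha hb q hq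
    simp only [Prod.fst_add, Prod.snd_add, inner_add_left]
    rw [ha q hq, hb q hq]
  · intro q hq
    simp
  · intro c a ha q hq
    simp only [Prod.smul_fst, Prod.smul_snd, inner_smul_left]
    rw [ha q hq]

lemma adjR_closed {H K : Type*} [NormedAddCommGroup H] [InnerProductSpace ℂ H]
    [NormedAddCommGroup K] [InnerProductSpace ℂ K] (S : Set (K × H)) :
    IsClosed (adjR S) := by
  have : adjR S = ⋂ q ∈ S, {p : H × K | ⟪p.1, q.2⟫ = ⟪p.2, q.1⟫} := by
    ext p; simp [adjR]
  rw [this]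
  refine isClosed_biInter fun q _ => isClosed_eq ?_ ?_ <;> fun_prop

lemma adjR_closure {H K : Type*} [NormedAddCommGroup H] [InnerProductSpace ℂ H]
    [NormedAddCommGroup K] [InnerProductSpace ℂ K] (S : Set (K × H)) :
    adjR (closure S) = adjR S := by
  apply Set.Subset.antisymm
  · intro p hp q hq
    exact hp q (subset_closure hq)
  · intro p hp q hq
    have hc : IsClosed {q : K × H | ⟪p.1, q.2⟫ = ⟪p.2, q.1⟫} := by
      refine isClosed_eq ?_ ?_ <;> fun_prop
    exact closure_minimal (fun q hq => hp q hq) hc hq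

/-- basic estimate for symmetric relations -/
lemma sym_est {S : Set (H × H)} (hS : S ⊆ adjR S) (l : ℂ) {p : H × H} (hp : p ∈ S) :
    |l.im| * ‖p.1‖ ≤ ‖p.2 - l • p.1‖ := by
  have h1 : ⟪p.1, p.2⟫ = ⟪p.2, p.1⟫ := hS hp p hp
  have h2 : (⟪p.1, p.2⟫).im = 0 := by
    have h3 := inner_conj_symm (𝕜 := ℂ) p.1 p.2
    rw [← h1] at h3
    exact Complex.conj_eq_iff_im.1 h3
  have h4 : (⟪p.1, p.2 - l • p.1⟫).im = - l.im * ‖p.1‖ ^ 2 := by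
    rw [inner_sub_right, inner_smul_right, inner_self_eq_norm_sq_to_K, Complex.sub_im, h2]
    simp [← Complex.ofReal_pow]
  have h5 : |l.im| * ‖p.1‖ ^ 2 ≤ ‖p.1‖ * ‖p.2 - l • p.1‖ := by
    have h6 := norm_inner_le_norm (𝕜 := ℂ) p.1 (p.2 - l • p.1)
    have h7 := Complex.abs_im_le_norm (⟪p.1, p.2 - l • p.1⟫)
    rw [h4, abs_mul, abs_neg, abs_of_nonneg (sq_nonneg ‖p.1‖)] at h7
    exact h7.trans h6
  by_cases h0 : ‖p.1‖ = 0
  · rw [h0]; simp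
  · have hpos : 0 < ‖p.1‖ := lt_of_le_of_ne (norm_nonneg _) (Ne.symm h0)
    refine le_of_mul_le_mul_left ?_ hpos
    nlinarith

lemma sym_uniq {S : Set (H × H)} (hS : S = adjR S) {l : ℂ} (hl : l.im ≠ 0) {p q : H × H}
    (hp : p ∈ S) (hq : q ∈ S) (h : p.2 - l • p.1 = q.2 - l • q.1) : p = q := by
  obtain ⟨P, hP⟩ := adjR_lin S
  rw [← hS] at hP
  have hd : p - q ∈ S := by
    rw [← hP] at hp hq ⊢
    exact P.sub_mem hp hq
  have h1 := sym_est hS.subset l hd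
  have h2 : (p - q).2 - l • (p - q).1 = 0 := by
    have : (p - q).2 - l • (p - q).1 = (p.2 - l • p.1) - (q.2 - l • q.1) := by
      simp only [Prod.fst_sub, Prod.snd_sub, smul_sub]; abel
    rw [this, h, sub_self]
  rw [h2, norm_zero] at h1
  have h3 : ‖(p - q).1‖ = 0 := by
    have := abs_pos.2 hl
    have h4 := norm_nonneg (p - q).1
    nlinarith
  have h5 : (p - q).1 = 0 := norm_eq_zero.1 h3
  rw [h5, smul_zero, sub_zero] at h2
  have : p - q = 0 := Prod.ext h5 h2
  exact sub_eq_zero.1 this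

lemma sa_range [CompleteSpace H] {S : Set (H × H)} (hS : S = adjR S) {l : ℂ} (hl : l.im ≠ 0)
    (x : H) : ∃ p ∈ S, p.2 - l • p.1 = x := by
  obtain ⟨P, hP⟩ := adjR_lin S
  rw [← hS] at hP
  have hcl : IsClosed (P : Set (H × H)) := by rw [hP, hS]; exact adjR_closed S
  let L : H × H →L[ℂ] H := ContinuousLinearMap.snd ℂ H H - l • ContinuousLinearMap.fst ℂ H H
  let LP : P →L[ℂ] H := L.comp P.subtypeL
  have : CompleteSpace P := hcl.completeSpace_coe
  have hpos := abs_pos.2 hl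
  have hanti : ∃ c : NNReal, AntilipschitzWith c LP := by
    refine ⟨⟨1 + (1 + ‖l‖) / |l.im|, by positivity⟩, ?_⟩
    refine AddMonoidHomClass.antilipschitz_of_bound LP ?_
    intro p
    have h1 := sym_est hS.subset l (hP ▸ p.2 : (p : H × H) ∈ S)
    have h2 : LP p = (p : H × H).2 - l • (p : H × H).1 := rfl
    rw [← h2] at h1
    have h3 : ‖(p : H × H).1‖ ≤ ‖LP p‖ / |l.im| := by
      rw [le_div_iff₀ hpos]; linarith
    have h4 : ‖(p : H × H).2‖ ≤ ‖LP p‖ + ‖l‖ * ‖(p : H × H).1‖ := by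
      have : (p : H × H).2 = LP p + l • (p : H × H).1 := by rw [h2]; abel
      rw [this]
      refine (norm_add_le _ _).trans ?_
      rw [norm_smul]
    have h5 : ‖p‖ = max ‖(p : H × H).1‖ ‖(p : H × H).2‖ := rfl
    rw [h5]
    have e : (1 + (1 + ‖l‖) / |l.im|) * ‖LP p‖
        = ‖LP p‖ + ‖LP p‖ / |l.im| + ‖l‖ * (‖LP p‖ / |l.im|) := by
      field_simp
      ring
    show _ ≤ (1 + (1 + ‖l‖) / |l.im|) * ‖LP p‖
    rw [e]
    have h6 : 0 ≤ ‖LP p‖ := norm_nonneg _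
    have h7 : ‖l‖ * ‖(p : H × H).1‖ ≤ ‖l‖ * (‖LP p‖ / |l.im|) := by gcongr
    have h8 : 0 ≤ ‖l‖ * (‖LP p‖ / |l.im|) := by positivity
    have h9 : 0 ≤ ‖LP p‖ / |l.im| := by positivity
    refine max_le ?_ ?_ <;> linarith
  obtain ⟨c, hc⟩ := hanti
  have hrc : IsClosed (LinearMap.range (LP : P →ₗ[ℂ] H) : Set H) := by
    have := hc.isClosed_range LP.uniformContinuous
    exact this
  have htop : LinearMap.range (LP : P →ₗ[ℂ] H) = ⊤ := by
    have : CompleteSpace (LinearMap.range (LP : P →ₗ[ℂ] H)) := hrc.completeSpace_coe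
    rw [← Submodule.orthogonal_eq_bot_iff]
    rw [Submodule.eq_bot_iff]
    intro k hk
    have hk1 : (k, (starRingEnd ℂ) l • k) ∈ S := by
      rw [hS]
      intro q hq
      rw [← hP] at hq
      have h1 := (Submodule.mem_orthogonal' _ _).1 hk (LP ⟨q, hq⟩) ⟨⟨q, hq⟩, rfl⟩
      have h2 : LP ⟨q, hq⟩ = q.2 - l • q.1 := rfl
      rw [h2, inner_sub_right, inner_smul_right, sub_eq_zero] at h1
      simp only [inner_smul_left, Complex.conj_conj]
      exact h1
    have h0 : ((0 : H), (0 : H)) ∈ S := by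
      rw [← hP]; exact P.zero_mem
    have := sym_uniq hS (l := (starRingEnd ℂ) l) (by simpa using hl) hk1 h0 (by simp)
    exact congrArg Prod.fst this
  have hx : x ∈ LinearMap.range (LP : P →ₗ[ℂ] H) := by rw [htop]; trivial
  obtain ⟨p, hp⟩ := hx
  exact ⟨p, hP ▸ p.2, hp⟩

/-- existence of the resolvent of a selfadjoint relation -/
lemma exists_resolvent [CompleteSpace H] {S : Set (H × H)} (hS : S = adjR S) :
    ∃ R : ℂ → H →L[ℂ] H,
      (∀ l : ℂ, l.im ≠ 0 → ∀ x, (R l x, x + l • R l x) ∈ S) ∧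
      (∀ l : ℂ, l.im ≠ 0 → ∀ k ∈ S, R l (k.2 - l • k.1) = k.1) := by
  obtain ⟨P, hP⟩ := adjR_lin S
  rw [← hS] at hP
  have key : ∀ l : ℂ, ∃ R : H →L[ℂ] H, l.im ≠ 0 → ∀ x, (R x, x + l • R x) ∈ S := by
    intro l
    by_cases hl : l.im ≠ 0
    · choose r hr hr2 using sa_range hS hl
      have hpos := abs_pos.2 hl
      let R0 : H →ₗ[ℂ] H :=
        { toFun := fun x => (r x).1
          map_add' := by
            intro x y
            have : r (x + y) = r x + r y := by
              refine sym_uniq hS hl (hr _) ?_ ?_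
              · have h1 := hr x
                have h2 := hr y
                rw [← hP] at *
                exact P.add_mem h1 h2
              · rw [hr2]
                simp only [Prod.fst_add, Prod.snd_add, smul_add]
                rw [add_sub_add_comm, hr2, hr2]
            rw [this]; rfl
          map_smul' := by
            intro c x
            have : r (c • x) = c • r x := by
              refine sym_uniq hS hl (hr _) ?_ ?_
              · have h1 := hr x
                rw [← hP] at *
                exact P.smul_mem c h1
              · rw [hr2]
                simp only [Prod.smul_fst, Prod.smul_snd]
                rw [smul_comm l c, ← smul_sub, hr2]
            rw [this]; rfl }
      refine ⟨R0.mkContinuous (1 / |l.im|) ?_, fun _ x => ?_⟩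
      · intro x
        have h1 := sym_est hS.subset l (hr x)
        rw [hr2] at h1
        show ‖(r x).1‖ ≤ _
        rw [one_div, inv_mul_eq_div, le_div_iff₀ hpos]; linarith
      · show ((r x).1, x + l • (r x).1) ∈ S
        have : ((r x).1, x + l • (r x).1) = r x := by
          refine Prod.ext rfl ?_
          show x + l • (r x).1 = (r x).2
          have := hr2 x
          rw [sub_eq_iff_eq_add] at this
          exact this.symm
        rw [this]; exact hr x
    · exact ⟨0, fun h => absurd h hl⟩
  choose R hR using key
  refine ⟨R, hR, ?_⟩
  intro l hl k hk
  have := sym_uniq hS hl (hR l hl (k.2 - l • k.1)) hk (by simp)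
  exact congrArg Prod.fst this

lemma resolvent_identity {S : Set (H × H)} (hS : S = adjR S) {R : ℂ → H →L[ℂ] H}
    (h1 : ∀ l : ℂ, l.im ≠ 0 → ∀ x, (R l x, x + l • R l x) ∈ S)
    (h2 : ∀ l : ℂ, l.im ≠ 0 → ∀ k ∈ S, R l (k.2 - l • k.1) = k.1)
    {l m : ℂ} (hl : l.im ≠ 0) (hm : m.im ≠ 0) (x : H) :
    (m - l) • R m (R l x) = R m x - R l x := by
  have h3 := h2 m hm _ (h1 l hl x)
  simp only at h3
  have : x + l • R l x - m • R l x = x - (m - l) • R l x := by rw [sub_smul]; abel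
  rw [this, map_sub, map_smul] at h3
  rw [eq_sub_iff_add_eq]
  exact (sub_eq_iff_eq_add'.1 h3).symm

lemma resolvent_adjoint [CompleteSpace H] {S : Set (H × H)} (hS : S = adjR S)
    {R : ℂ → H →L[ℂ] H}
    (h1 : ∀ l : ℂ, l.im ≠ 0 → ∀ x, (R l x, x + l • R l x) ∈ S)
    {l : ℂ} (hl : l.im ≠ 0) :
    R ((starRingEnd ℂ) l) = ContinuousLinearMap.adjoint (R l) := by
  rw [ContinuousLinearMap.eq_adjoint_iff]
  intro x y
  have hl' : ((starRingEnd ℂ) l).im ≠ 0 := by simpa using hl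
  have h3 := hS.subset (h1 _ hl' x) _ (h1 l hl y)
  simp only [inner_add_left, inner_add_right, inner_smul_left, inner_smul_right,
    Complex.conj_conj] at h3
  exact add_right_cancel h3

lemma resolvent_diff [CompleteSpace H] {S : Set (H × H)} (hS : S = adjR S)
    {R : ℂ → H →L[ℂ] H}
    (h1 : ∀ l : ℂ, l.im ≠ 0 → ∀ x, (R l x, x + l • R l x) ∈ S)
    (h2 : ∀ l : ℂ, l.im ≠ 0 → ∀ k ∈ S, R l (k.2 - l • k.1) = k.1)
    {l : ℂ} (hl : l.im ≠ 0) : DifferentiableAt ℂ R l := by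
  let f : ℂ → H →L[ℂ] H := fun m => 1 - (m - l) • R l
  have hf : DifferentiableAt ℂ f l := by fun_prop
  have hfl : f l = 1 := by simp [f]
  have hinv : DifferentiableAt ℂ (fun m => Ring.inverse (f m)) l := by
    have := differentiableAt_inverse (𝕜 := ℂ) (x := (1 : H →L[ℂ] H)) isUnit_one
    rw [← hfl] at this
    exact DifferentiableAt.comp l this hf
  have hev : R =ᶠ[𝓝 l] fun m => R l * Ring.inverse (f m) := by
    have hu : ∀ᶠ m in 𝓝 l, IsUnit (f m) := by
      have hO : IsOpen {x : H →L[ℂ] H | IsUnit x} := Units.isOpen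
      have : {x : H →L[ℂ] H | IsUnit x} ∈ 𝓝 (f l) := by
        rw [hfl]; exact hO.mem_nhds isUnit_one
      exact hf.continuousAt this
    have hi : ∀ᶠ m in 𝓝 l, m.im ≠ 0 :=
      (Complex.continuous_im.continuousAt (x := l)).eventually_ne hl
    filter_upwards [hu, hi] with m hm hm'
    have h3 : R m * f m = R l := by
      ext x
      have := resolvent_identity hS h1 h2 hl hm' x
      show R m (x - (m - l) • R l x) = R l x
      rw [map_sub, map_smul]
      rw [this]; abel
    rw [← h3, mul_assoc, Ring.mul_inverse_cancel _ hm, mul_one]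
  refine DifferentiableAt.congr_of_eventuallyEq ?_ hev
  exact DifferentiableAt.mul (by fun_prop) hinv

lemma dense_of {X Y : Type*} [NormedAddCommGroup X] [InnerProductSpace ℂ X] [CompleteSpace X]
    [NormedAddCommGroup Y] [InnerProductSpace ℂ Y] [CompleteSpace Y] (L : X →L[ℂ] Y)
    (hL : ∀ y, ContinuousLinearMap.adjoint L y = 0 → y = 0) : DenseRange L := by
  have : (LinearMap.range (L : X →ₗ[ℂ] Y)).topologicalClosure = ⊤ := by
    rw [Submodule.topologicalClosure_eq_top_iff, Submodule.eq_bot_iff]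
    intro y hy
    apply hL
    apply ext_inner_right ℂ
    intro z
    rw [ContinuousLinearMap.adjoint_inner_left, inner_zero_left]
    exact (Submodule.mem_orthogonal' _ _).1 hy _ ⟨z, rfl⟩
  exact Submodule.dense_iff_topologicalClosure_eq_top.2 this

/-- parametrization of a closed densely defined operator by an injective contraction -/
lemma exists_polar {K F : Type*} [NormedAddCommGroup K] [InnerProductSpace ℂ K] [CompleteSpace K]
    [NormedAddCommGroup F] [InnerProductSpace ℂ F] [CompleteSpace F]
    (π : K →L[ℂ] F) (hinj : ∀ x, π x = 0 → x = 0) (hd : DenseRange π) :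
    ∃ W : F →L[ℂ] K, (∀ x, ‖W x‖ = ‖x‖) ∧ Function.Surjective W := by
  let T : F →L[ℂ] F := π.comp (ContinuousLinearMap.adjoint π)
  have hT : 0 ≤ T := by
    rw [ContinuousLinearMap.nonneg_iff_isPositive]
    have := ContinuousLinearMap.IsPositive.conj_adjoint
      (ContinuousLinearMap.isPositive_one (𝕜 := ℂ) (E := K)) π
    exact this
  let G : F →L[ℂ] F := CFC.sqrt T
  have hGG : G * G = T := CFC.sqrt_mul_sqrt_self T hT
  have hGsa : ContinuousLinearMap.adjoint G = G := by
    have : IsSelfAdjoint G := IsSelfAdjoint.of_nonneg (CFC.sqrt_nonneg T)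
    exact this.adjoint_eq
  have hnorm : ∀ x, ‖ContinuousLinearMap.adjoint π x‖ = ‖G x‖ := by
    intro x
    have e1 : ⟪ContinuousLinearMap.adjoint π x, ContinuousLinearMap.adjoint π x⟫ = ⟪G x, G x⟫ := by
      rw [ContinuousLinearMap.adjoint_inner_left]
      have : ⟪G x, G x⟫ = ⟪x, G (G x)⟫ := by
        conv_lhs => rw [← hGsa]
        rw [ContinuousLinearMap.adjoint_inner_left, hGsa]
      rw [this]
      have h3 : G (G x) = T x := by rw [← hGG]; rfl
      rw [h3]; rfl
    rw [inner_self_eq_norm_sq_to_K, inner_self_eq_norm_sq_to_K] at e1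
    have e2 : ‖ContinuousLinearMap.adjoint π x‖ ^ 2 = ‖G x‖ ^ 2 := by exact_mod_cast e1
    exact (sq_eq_sq₀ (norm_nonneg _) (norm_nonneg _)).1 e2
  have hGinj : ∀ x, G x = 0 → x = 0 := by
    intro x hx
    have h1 : ContinuousLinearMap.adjoint π x = 0 := by
      rw [← norm_eq_zero, hnorm, hx, norm_zero]
    have h2 : ∀ y, ⟪x, π y⟫ = 0 := by
      intro y
      rw [← ContinuousLinearMap.adjoint_inner_left, h1, inner_zero_left]
    have h3 : ∀ z, ⟪x, z⟫ = 0 := by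
      intro z
      have hc : IsClosed {z : F | ⟪x, z⟫ = 0} := isClosed_eq (by fun_prop) (by fun_prop)
      exact closure_minimal (by rintro _ ⟨y, rfl⟩; exact h2 y) hc (hd z)
    exact inner_self_eq_zero.1 (h3 x)
  have hGd : DenseRange G := dense_of G (by rw [hGsa]; exact hGinj)
  have hπd : DenseRange (ContinuousLinearMap.adjoint π) := 
    dense_of _ (by rw [ContinuousLinearMap.adjoint_adjoint]; exact hinj)
  let W : F →L[ℂ] K := LinearMap.extendOfNorm (ContinuousLinearMap.adjoint π : F →ₗ[ℂ] K)
    (G : F →ₗ[ℂ] F)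
  have hW : ∀ x, W (G x) = ContinuousLinearMap.adjoint π x := by
    intro x
    exact LinearMap.extendOfNorm_eq hGd ⟨1, fun x => by rw [one_mul]; exact (hnorm x).le⟩ x
  have hWn : ∀ x, ‖W x‖ = ‖x‖ := by
    intro x
    have hc : IsClosed {x : F | ‖W x‖ = ‖x‖} := isClosed_eq (by fun_prop) (by fun_prop)
    refine closure_minimal ?_ hc (hGd x)
    rintro _ ⟨y, rfl⟩
    show ‖W (G y)‖ = _
    rw [hW, hnorm]
  refine ⟨W, hWn, ?_⟩
  have hWi : Isometry W := AddMonoidHomClass.isometry_of_norm W hWn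
  have hcl : IsClosed (Set.range W) := hWi.isClosedEmbedding.isClosed_range
  intro y
  have : closure (Set.range (ContinuousLinearMap.adjoint π)) ⊆ Set.range W := by
    refine closure_minimal ?_ hcl
    rintro _ ⟨x, rfl⟩
    exact ⟨G x, hW x⟩
  exact this (hπd y)

lemma exists_param {F E : Type*} [NormedAddCommGroup F] [InnerProductSpace ℂ F] [CompleteSpace F]
    [NormedAddCommGroup E] [InnerProductSpace ℂ E] [CompleteSpace E]
    (P : Submodule ℂ (F × E)) (hcl : IsClosed (P : Set (F × E)))
    (hsv : ∀ f, ((0 : F), f) ∈ P → f = 0) (hd : Dense {x : F | ∃ f, (x, f) ∈ P}) :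
    ∃ (G : F →L[ℂ] F) (B : F →L[ℂ] E), (∀ u, G u = 0 → u = 0) ∧
      (∀ p, p ∈ P ↔ ∃ u, p = (G u, B u)) ∧
      (∀ u, ‖u‖ ≤ ‖G u‖ + ‖B u‖) := by
  let c := WithLp.prodContinuousLinearEquiv 2 ℂ F E
  let Q : Submodule ℂ (WithLp 2 (F × E)) := P.comap (c : WithLp 2 (F × E) →ₗ[ℂ] F × E)
  have hQ : IsClosed (Q : Set (WithLp 2 (F × E))) := hcl.preimage c.continuous
  have : CompleteSpace Q := hQ.completeSpace_coe
  let π : Q →L[ℂ] F := (ContinuousLinearMap.fst ℂ F E).comp ((c : WithLp 2 (F × E) →L[ℂ] F × E).comp Q.subtypeL)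
  let ρ : Q →L[ℂ] E := (ContinuousLinearMap.snd ℂ F E).comp ((c : WithLp 2 (F × E) →L[ℂ] F × E).comp Q.subtypeL)
  have hmem : ∀ x : Q, (π x, ρ x) ∈ P := fun x => x.2
  have hext : ∀ x y : Q, π x = π y → ρ x = ρ y → x = y := by
    intro x y h1 h2
    apply Subtype.ext
    apply c.injective
    exact Prod.ext h1 h2
  have hn : ∀ x : Q, ‖x‖ ≤ ‖π x‖ + ‖ρ x‖ := by
    intro x
    have h1 : ‖x‖ ^ 2 = ‖π x‖ ^ 2 + ‖ρ x‖ ^ 2 := WithLp.prod_norm_sq_eq_of_L2 (x : WithLp 2 (F × E))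
    have h2 := norm_nonneg (π x)
    have h3 := norm_nonneg (ρ x)
    refine abs_le_of_sq_le_sq' ?_ (by positivity) |>.2
    nlinarith
  have hinj : ∀ x, π x = 0 → x = 0 := by
    intro x hx
    have h1 := hmem x
    rw [hx] at h1
    exact hext x 0 (by rw [hx, map_zero]) (by rw [hsv _ h1, map_zero])
  have hdr : DenseRange π := by
    refine hd.mono ?_
    rintro x ⟨f, hf⟩
    exact ⟨⟨c.symm (x, f), by show c (c.symm (x, f)) ∈ P; rw [c.apply_symm_apply]; exact hf⟩, by
      show (c (c.symm (x, f))).1 = x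
      rw [c.apply_symm_apply]⟩
  obtain ⟨W, hW, hWs⟩ := exists_polar π hinj hdr
  refine ⟨π.comp W, ρ.comp W, ?_, ?_, ?_⟩
  · intro u hu
    have := hinj _ hu
    rw [← norm_eq_zero, ← hW, ← norm_zero (E := Q)]
    exact congrArg norm this
  · intro p
    constructor
    · intro hp
      obtain ⟨u, hu⟩ := hWs ⟨c.symm p, by show c (c.symm p) ∈ P; rw [c.apply_symm_apply]; exact hp⟩
      refine ⟨u, ?_⟩
      show p = (π (W u), ρ (W u))
      rw [hu]
      show p = ((c (c.symm p)).1, (c (c.symm p)).2)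
      rw [c.apply_symm_apply]
    · rintro ⟨u, rfl⟩
      exact hmem (W u)
  · intro u
    rw [← hW u]
    exact hn _

end Generic

section Abstract

/-- the bounded Nevanlinna function `B* (l + (l² + 1) R(l)) B` -/
def Npar (R : ℂ → E →L[ℂ] E) (B : F →L[ℂ] E) (l : ℂ) : F →L[ℂ] F :=
  (ContinuousLinearMap.adjoint B).comp
    ((l • ContinuousLinearMap.id ℂ E + (l ^ 2 + 1) • R l).comp B)

lemma Npar_apply (R : ℂ → E →L[ℂ] E) (B : F →L[ℂ] E) (l : ℂ) (u : F) :
    Npar R B l u = ContinuousLinearMap.adjoint B (l • B u + (l ^ 2 + 1) • R l (B u)) := rfl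

lemma Npar_nev {C : Set (E × E)} (hC : C = adjR C) {R : ℂ → E →L[ℂ] E}
    (h1 : ∀ l : ℂ, l.im ≠ 0 → ∀ x, (R l x, x + l • R l x) ∈ C)
    (h2 : ∀ l : ℂ, l.im ≠ 0 → ∀ k ∈ C, R l (k.2 - l • k.1) = k.1) (B : F →L[ℂ] E) :
    IsNevFun (Npar R B) := by
  refine ⟨?_, ?_, ?_⟩
  · intro l hl
    apply DifferentiableAt.differentiableWithinAt
    have hR := resolvent_diff hC h1 h2 hl
    unfold Npar
    have h3 : DifferentiableAt ℂ
        (fun l : ℂ => l • ContinuousLinearMap.id ℂ E + (l ^ 2 + 1) • R l) l := by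
      fun_prop
    exact DifferentiableAt.clm_comp (by fun_prop) (DifferentiableAt.clm_comp h3 (by fun_prop))
  · intro l hl
    rw [ContinuousLinearMap.eq_adjoint_iff]
    intro x y
    rw [Npar_apply, Npar_apply, ContinuousLinearMap.adjoint_inner_left,
      ContinuousLinearMap.adjoint_inner_right, resolvent_adjoint hC h1 hl]
    simp only [inner_add_left, inner_add_right, inner_smul_left, inner_smul_right,
      ContinuousLinearMap.adjoint_inner_left]
    simp
  · intro l hl u
    rw [Npar_apply, ContinuousLinearMap.adjoint_inner_right]
    set x := B u
    have hm := h1 l hl.ne' x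
    set y := R l x
    have hs : ⟪y, x + l • y⟫ = ⟪x + l • y, y⟫ := hC.subset hm _ hm
    have hxy : ⟪y, x⟫ = (starRingEnd ℂ) ⟪x, y⟫ := (inner_conj_symm _ _).symm
    have hq : 0 ≤ (⟪x + (l - Complex.I) • y, x + (l - Complex.I) • y⟫).re := inner_self_nonneg (𝕜 := ℂ)
    simp only [inner_add_left, inner_add_right, inner_smul_left, inner_smul_right, hxy] at hs hq ⊢
    rw [inner_self_eq_norm_sq_to_K (𝕜 := ℂ) y] at hs hq
    rw [inner_self_eq_norm_sq_to_K (𝕜 := ℂ) x] at hq ⊢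
    set a := ⟪x, y⟫
    have hs' := congrArg Complex.im hs
    simp [← Complex.ofReal_pow] at hs' hq ⊢
    set X := ‖x‖ ^ 2
    set Y := ‖y‖ ^ 2
    have hY : a.im = l.im * Y := by linarith
    have e : l.im * X + (((l ^ 2).re + 1) * a.im + (l ^ 2).im * a.re) =
      l.im * (X + ((l.re) ^ 2 + 1 - l.im ^ 2) * Y + 2 * l.re * a.re) := by
      rw [hY]
      simp [pow_two]; ring
    rw [hY] at hq
    rw [e]
    apply mul_nonneg hl.le
    nlinarith

/-- model pair with parameter `e` -/
def Prel (C : Set (E × E)) (B : F →L[ℂ] E) (e : Set (F × F)) : Set ((E × E) × (F × F)) :=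
  {q | ∃ k ∈ C, ∃ p ∈ e, q = ((k.1 + B p.1, k.2 + Complex.I • B p.1),
    (p.1, p.2 + ContinuousLinearMap.adjoint B (Complex.I • B p.1 + (k.2 + Complex.I • k.1))))}

lemma Prel_weyl {C : Set (E × E)} {R : ℂ → E →L[ℂ] E} (hCl : IsLinRel C)
    (h1 : ∀ l : ℂ, l.im ≠ 0 → ∀ x, (R l x, x + l • R l x) ∈ C)
    (h2 : ∀ l : ℂ, l.im ≠ 0 → ∀ k ∈ C, R l (k.2 - l • k.1) = k.1) (B : F →L[ℂ] E)
    (e : Set (F × F)) {l : ℂ} (hl : l.im ≠ 0) :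
    weyl (Prel C B e) l = {p : F × F | ∃ w, (p.1, w) ∈ e ∧ p.2 = w + Npar R B l p.1} := by
  obtain ⟨P, rfl⟩ := hCl
  ext ⟨u, v⟩
  constructor
  · rintro ⟨f, k, hk, p, hp, h⟩
    simp only [Prod.mk.injEq] at h
    obtain ⟨⟨h3, h4⟩, h5, h6⟩ := h
    subst h5
    refine ⟨p.2, hp, ?_⟩
    show v = _
    rw [h6, Npar_apply]
    congr 2
    have h7 : k.2 = l • k.1 + (l - Complex.I) • B p.1 := by
      rw [h3] at h4
      rw [← sub_eq_iff_eq_add] at h4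
      rw [← h4]; module
    have h8 : k.1 = (l - Complex.I) • R l (B p.1) := by
      rw [← map_smul, ← h2 l hl k hk, h7]
      congr 1; abel
    rw [h7, h8]
    match_scalars
    · ring
    · linear_combination -Complex.I_sq
  · rintro ⟨w, hw, hv⟩
    simp only at hw hv
    refine ⟨(l - Complex.I) • R l (B u) + B u, (l - Complex.I) • (R l (B u), B u + l • R l (B u)),
      P.smul_mem _ (h1 l hl _), (u, w), hw, ?_⟩
    simp only [Prod.mk.injEq, Prod.smul_fst, Prod.smul_snd, true_and]
    refine ⟨?_, ?_⟩
    · module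
    · rw [hv, Npar_apply]
      congr 2
      match_scalars
      · ring
      · linear_combination Complex.I_sq

lemma Prel_closed {C : Set (E × E)} (hC : IsClosed C) (B : F →L[ℂ] E)
    {e : Set (F × F)} (he : IsClosed e) : IsClosed (Prel C B e) := by
  let φ : (E × E) × (F × F) → E × E :=
    fun q => (q.1.1 - B q.2.1, q.1.2 - Complex.I • B q.2.1)
  let ψ : (E × E) × (F × F) → F × F := fun q =>
    (q.2.1, q.2.2 - ContinuousLinearMap.adjoint B (Complex.I • B q.2.1 +
      ((φ q).2 + Complex.I • (φ q).1)))
  have hφ : Continuous φ := by fun_prop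
  have hψ : Continuous ψ := by fun_prop
  have : Prel C B e = φ ⁻¹' C ∩ ψ ⁻¹' e := by
    ext q
    constructor
    · rintro ⟨k, hk, p, hp, rfl⟩
      refine ⟨?_, ?_⟩
      · simpa [φ] using hk
      · simpa [φ, ψ] using hp
    · rintro ⟨h3, h4⟩
      refine ⟨_, h3, _, h4, ?_⟩
      simp [φ, ψ]
  rw [this]
  exact (hC.preimage hφ).inter (he.preimage hψ)

lemma Prel_lin {C : Set (E × E)} (hC : IsLinRel C) (B : F →L[ℂ] E)
    {e : Set (F × F)} (he : IsLinRel e) : IsLinRel (Prel C B e) := by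
  obtain ⟨P, rfl⟩ := hC
  obtain ⟨Q, rfl⟩ := he
  refine ⟨{ carrier := Prel P B Q, add_mem' := ?_, zero_mem' := ?_, smul_mem' := ?_ }, rfl⟩
  · rintro _ _ ⟨k, hk, p, hp, rfl⟩ ⟨k', hk', p', hp', rfl⟩
    refine ⟨k + k', P.add_mem hk hk', p + p', Q.add_mem hp hp', ?_⟩
    simp only [Prod.mk_add_mk, Prod.fst_add, Prod.snd_add, map_add, smul_add, Prod.mk.injEq]
    refine ⟨⟨?_, ?_⟩, trivial, ?_⟩ <;> abel
  · exact ⟨0, P.zero_mem, 0, Q.zero_mem, by simp; rfl⟩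
  · rintro c _ ⟨k, hk, p, hp, rfl⟩
    refine ⟨c • k, P.smul_mem _ hk, c • p, Q.smul_mem _ hp, ?_⟩
    simp only [Prod.smul_mk, Prod.smul_fst, Prod.smul_snd, map_add, map_smul, smul_add,
      smul_comm c Complex.I]

lemma Prel_A0 {C : Set (E × E)} (B : F →L[ℂ] E)
    {e : Set (F × F)} (he : (0 : F × F) ∈ e) : A0 (Prel C B e) = C := by
  ext f
  constructor
  · rintro ⟨h', k, hk, p, hp, h⟩
    simp only [Prod.mk.injEq] at h
    obtain ⟨h3, h5, -⟩ := h
    rw [← h5] at h3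
    have : f = k := by rw [h3]; simp
    rw [this]; exact hk
  · intro hf
    exact ⟨_, f, hf, 0, he, by simp; rfl⟩

end Abstract

section Unitary

lemma unitary_lin {Γ : Set ((E × E) × (F × F))} (h : invR Γ = kreinAdj Γ) : IsLinRel Γ := by
  have key : ∀ p : (E × E) × (F × F), p ∈ Γ ↔ ∀ q ∈ Γ, kIP q.1 p.1 = kIP q.2 p.2 := by
    intro p
    have : p ∈ Γ ↔ (p.2, p.1) ∈ invR Γ := Iff.rfl
    rw [this, h]; rfl
  refine ⟨{ carrier := Γ, add_mem' := ?_, zero_mem' := ?_, smul_mem' := ?_ }, rfl⟩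
  · intro a b ha hb
    rw [key] at ha hb ⊢
    intro q hq
    have h1 := ha q hq
    have h2 := hb q hq
    simp only [kIP, Prod.fst_add, Prod.snd_add, inner_add_left] at *
    linear_combination h1 + h2
  · rw [key]
    intro q hq
    simp [kIP]
  · intro c a ha
    rw [key] at ha ⊢
    intro q hq
    have h1 := ha q hq
    simp only [kIP, Prod.smul_fst, Prod.smul_snd, inner_smul_left] at *
    linear_combination (starRingEnd ℂ) c * h1

lemma unitary_solve {Γ : Set ((E × E) × (F × F))} (h : invR Γ = kreinAdj Γ) {l : ℂ}
    (hl : l.im ≠ 0) (d : E) (v : F) :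
    ∃ p ∈ Γ, p.1.2 - l • p.1.1 = d ∧ -p.2.2 - l • p.2.1 = v ∧
      |l.im| * ‖p.1.1‖ ≤ ‖d‖ + ‖v‖ ∧ |l.im| * ‖p.2.1‖ ≤ ‖d‖ + ‖v‖ := by
  have key : ∀ p : (E × E) × (F × F), p ∈ Γ ↔ ∀ q ∈ Γ, kIP q.1 p.1 = kIP q.2 p.2 := by
    intro p
    have : p ∈ Γ ↔ (p.2, p.1) ∈ invR Γ := Iff.rfl
    rw [this, h]; rfl
  let S : Set (WithLp 2 (E × F) × WithLp 2 (E × F)) :=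
    {s | ((s.1.fst, s.2.fst), (s.1.snd, -s.2.snd)) ∈ Γ}
  have hS : S = adjR S := by
    ext s
    show ((s.1.fst, s.2.fst), (s.1.snd, -s.2.snd)) ∈ Γ ↔ _
    rw [key]
    constructor
    · intro hs q hq
      have h1 := hs _ hq
      simp only [kIP, inner_neg_left, inner_neg_right] at h1
      rw [WithLp.prod_inner_apply, WithLp.prod_inner_apply]
      have h2 : Complex.I * (⟪s.1.fst, q.2.fst⟫ + ⟪s.1.snd, q.2.snd⟫
        - (⟪s.2.fst, q.1.fst⟫ + ⟪s.2.snd, q.1.snd⟫)) = 0 := by linear_combination -h1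
      have h3 := (mul_eq_zero.1 h2).resolve_left Complex.I_ne_zero
      exact sub_eq_zero.1 h3
    · intro hs q hq
      have hq' : (WithLp.toLp 2 (q.1.1, q.2.1), WithLp.toLp 2 (q.1.2, -q.2.2)) ∈ S := by
        show ((q.1.1, q.1.2), (q.2.1, - -q.2.2)) ∈ Γ
        rw [neg_neg]; exact hq
      have h1 := hs _ hq'
      rw [WithLp.prod_inner_apply, WithLp.prod_inner_apply] at h1
      change ⟪s.1.fst, q.1.2⟫ + ⟪s.1.snd, -q.2.2⟫ = ⟪s.2.fst, q.1.1⟫ + ⟪s.2.snd, q.2.1⟫ at h1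
      simp only [kIP, inner_neg_left, inner_neg_right] at h1 ⊢
      linear_combination -Complex.I * h1
  obtain ⟨s, hs, hs2⟩ := sa_range hS hl (WithLp.toLp 2 (d, v))
  have hest := sym_est hS.subset l hs
  rw [hs2] at hest
  have hn : ‖WithLp.toLp 2 (d, v)‖ ≤ ‖d‖ + ‖v‖ := by
    have h1 := WithLp.prod_norm_sq_eq_of_L2 (WithLp.toLp 2 (d, v))
    change _ = ‖d‖ ^ 2 + ‖v‖ ^ 2 at h1
    have h2 := norm_nonneg d
    have h3 := norm_nonneg v
    refine abs_le_of_sq_le_sq' ?_ (by positivity) |>.2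
    nlinarith
  have h4 := WithLp.prod_norm_sq_eq_of_L2 s.1
  have h5 : ‖s.1.fst‖ ≤ ‖s.1‖ := by
    refine abs_le_of_sq_le_sq' ?_ (by positivity) |>.2
    nlinarith [sq_nonneg ‖s.1.snd‖]
  have h6 : ‖s.1.snd‖ ≤ ‖s.1‖ := by
    refine abs_le_of_sq_le_sq' ?_ (by positivity) |>.2
    nlinarith [sq_nonneg ‖s.1.fst‖]
  have habs := abs_nonneg l.im
  refine ⟨_, hs, ?_, ?_, ?_, ?_⟩
  · exact congrArg WithLp.fst hs2
  · have := congrArg WithLp.snd hs2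
    simp only [neg_neg]
    exact this
  · exact (mul_le_mul_of_nonneg_left h5 habs).trans (hest.trans hn)
  · exact (mul_le_mul_of_nonneg_left h6 habs).trans (hest.trans hn)

variable {P : Submodule ℂ ((E × E) × (F × F))}

lemma correct (h : invR (P : Set ((E × E) × (F × F))) = kreinAdj (P : Set ((E × E) × (F × F))))
    {l : ℂ} (hl : l.im ≠ 0) {p : (E × E) × (F × F)} {k : E × E}
    (hk : k ∈ closure (A0 (P : Set ((E × E) × (F × F)))))
    (hpk : p.1.2 + k.2 = l • (p.1.1 + k.1)) :
    ∃ a b : ℕ → (E × E) × (F × F), (∀ n, a n ∈ P) ∧ (∀ n, (a n).2.1 = 0) ∧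
      Tendsto (fun n => (a n).1) atTop (𝓝 k) ∧ (∀ n, b n ∈ P) ∧ Tendsto b atTop (𝓝 0) ∧
      ∀ n, (p + a n - b n).1.2 = l • (p + a n - b n).1.1 := by
  obtain ⟨s, hs, hsk⟩ := mem_closure_iff_seq_limit.1 hk
  choose h' hh' using hs
  let d : ℕ → E := fun n => p.1.2 + (s n).2 - l • (p.1.1 + (s n).1)
  have hd : Tendsto d atTop (𝓝 0) := by
    have hc : Continuous (fun k : E × E => p.1.2 + k.2 - l • (p.1.1 + k.1)) := by fun_prop
    have := (hc.tendsto k).comp hsk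
    rw [hpk, sub_self] at this
    exact this
  choose b hb hb1 hb2 hb3 hb4 using fun n => unitary_solve h hl (d n) 0
  have hpos := abs_pos.2 hl
  have hdn : Tendsto (fun n => ‖d n‖ / |l.im|) atTop (𝓝 0) := by
    have := hd.norm.div_const |l.im|
    simpa using this
  have t1 : Tendsto (fun n => (b n).1.1) atTop (𝓝 0) := by
    refine squeeze_zero_norm (fun n => ?_) hdn
    rw [le_div_iff₀ hpos]
    have := hb3 n
    rw [norm_zero, add_zero] at this
    linarith
  have t2 : Tendsto (fun n => (b n).2.1) atTop (𝓝 0) := by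
    refine squeeze_zero_norm (fun n => ?_) hdn
    rw [le_div_iff₀ hpos]
    have := hb4 n
    rw [norm_zero, add_zero] at this
    linarith
  have e3 : ∀ n, (b n).1.2 = d n + l • (b n).1.1 := fun n => by rw [← hb1 n]; abel
  have e4 : ∀ n, (b n).2.2 = - (l • (b n).2.1) := fun n => by
    have := hb2 n
    rw [sub_eq_zero] at this
    rw [← this, neg_neg]
  have t3 : Tendsto (fun n => (b n).1.2) atTop (𝓝 0) := by
    simp only [e3]
    have := hd.add (t1.const_smul l)
    simpa using this
  have t4 : Tendsto (fun n => (b n).2.2) atTop (𝓝 0) := by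
    simp only [e4]
    have := (t2.const_smul l).neg
    simpa using this
  refine ⟨fun n => (s n, (0, h' n)), b, fun n => hh' n, fun n => rfl, hsk, hb,
    (t1.prodMk_nhds t3).prodMk_nhds (t2.prodMk_nhds t4), ?_⟩
  intro n
  show p.1.2 + (s n).2 - (b n).1.2 = l • (p.1.1 + (s n).1 - (b n).1.1)
  rw [e3]
  simp only [d]
  module

lemma dense_dom (h : invR (P : Set ((E × E) × (F × F))) = kreinAdj (P : Set ((E × E) × (F × F))))
    (hG : GreenPair (P : Set ((E × E) × (F × F))))
    (hm : mulR (P : Set ((E × E) × (F × F))) = {0}) {l : ℂ} (hl : l.im ≠ 0) :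
    Dense {x : F | ∃ f, (x, f) ∈ gfield (P : Set ((E × E) × (F × F))) l} := by
  let D : Submodule ℂ F :=
    { carrier := {x : F | ∃ f, (x, f) ∈ gfield (P : Set ((E × E) × (F × F))) l}
      add_mem' := by
        rintro a b ⟨f, h1, hf⟩ ⟨g, h2, hg⟩
        refine ⟨f + g, h1 + h2, ?_⟩
        have := P.add_mem hf hg
        simpa using this
      zero_mem' := ⟨0, 0, by simp; exact P.zero_mem⟩
      smul_mem' := by
        rintro c a ⟨f, h1, hf⟩
        refine ⟨c • f, c • h1, ?_⟩
        have := P.smul_mem c hf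
        simpa [smul_comm c l] using this }
  show Dense (D : Set F)
  rw [Submodule.dense_iff_topologicalClosure_eq_top, Submodule.topologicalClosure_eq_top_iff,
    Submodule.eq_bot_iff]
  intro k hk
  have hl' : ((starRingEnd ℂ) l).im ≠ 0 := by simpa using hl
  obtain ⟨⟨⟨f, f'⟩, ⟨x, x'⟩⟩, hp, hp1, hp2, -, -⟩ := unitary_solve h hl' 0 k
  simp only at hp1 hp2
  rw [sub_eq_zero] at hp1
  have hx : x = 0 := by
    apply ext_inner_left ℂ
    intro v
    rw [inner_zero_right]
    obtain ⟨⟨⟨g, g'⟩, ⟨b, b'⟩⟩, hq, hq1, hq2, -, -⟩ := unitary_solve h hl 0 v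
    simp only at hq1 hq2
    rw [sub_eq_zero] at hq1
    have hbk : ⟪b, k⟫ = 0 := by
      refine (Submodule.mem_orthogonal _ _).1 hk b ⟨g, b', ?_⟩
      simp only
      rw [← hq1]
      exact hq
    have hgr := hG _ hp _ hq
    simp only at hgr
    rw [← hp2] at hbk
    rw [← hq2]
    rw [hp1, hq1] at hgr
    simp only [inner_sub_left, inner_sub_right, inner_neg_left, inner_neg_right, inner_smul_left,
      inner_smul_right] at hgr hbk ⊢
    linear_combination hbk - hgr
  rw [hx] at hp hp2
  have hgr := hG _ hp _ hp
  simp only at hgr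
  rw [hp1] at hgr
  simp only [inner_smul_left, inner_smul_right, inner_zero_left, inner_zero_right, sub_zero,
    Complex.conj_conj] at hgr
  have hff : ⟪f, f⟫ = 0 := by
    have h1 : ((starRingEnd ℂ) l - l) * ⟪f, f⟫ = 0 := by linear_combination hgr
    refine (mul_eq_zero.1 h1).resolve_left ?_
    intro h2
    have := congrArg Complex.im h2
    simp at this
    apply hl; linarith
  have hf : f = 0 := inner_self_eq_zero.1 hff
  rw [hf, smul_zero] at hp1
  rw [hp1, hf] at hp
  have hmm : ((0 : F), x') ∈ mulR (P : Set ((E × E) × (F × F))) := hp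
  rw [hm] at hmm
  have hx' : x' = 0 := congrArg Prod.snd hmm
  rw [← hp2, hx']; simp

/-- identity for the adjoint of the gamma field -/
lemma gfield_adj (hG : GreenPair (P : Set ((E × E) × (F × F)))) {l : ℂ} {k : E × E} {k1 : F}
    (hk : (k, ((0 : F), k1)) ∈ P) {p : F × E}
    (hp : p ∈ closure (gfield (P : Set ((E × E) × (F × F))) l)) :
    ⟪k.2 - (starRingEnd ℂ) l • k.1, p.2⟫ = ⟪k1, p.1⟫ := by
  have hc : IsClosed {p : F × E | ⟪k.2 - (starRingEnd ℂ) l • k.1, p.2⟫ = ⟪k1, p.1⟫} :=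
    isClosed_eq (by fun_prop) (by fun_prop)
  refine closure_minimal ?_ hc hp
  rintro ⟨x, f⟩ ⟨h', hf⟩
  have h1 := hG _ hf _ hk
  simp only [inner_smul_left, inner_smul_right, inner_zero_left, inner_sub_left,
    Set.mem_ofPred_eq, Complex.conj_conj] at h1 ⊢
  linear_combination -h1

lemma gfield_sv (hG : GreenPair (P : Set ((E × E) × (F × F))))
    (hC : closure (A0 (P : Set ((E × E) × (F × F)))) =
      adjR (closure (A0 (P : Set ((E × E) × (F × F))))))
    {l : ℂ} (hl : l.im ≠ 0) {f : E}
    (hp : ((0 : F), f) ∈ closure (gfield (P : Set ((E × E) × (F × F))) l)) : f = 0 := by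
  have hl' : ((starRingEnd ℂ) l).im ≠ 0 := by simpa using hl
  have h1 : ∀ k ∈ closure (A0 (P : Set ((E × E) × (F × F)))),
      ⟪k.2 - (starRingEnd ℂ) l • k.1, f⟫ = 0 := by
    intro k hk
    have hc : IsClosed {k : E × E | ⟪k.2 - (starRingEnd ℂ) l • k.1, f⟫ = 0} :=
      isClosed_eq (by fun_prop) (by fun_prop)
    refine closure_minimal ?_ hc hk
    rintro k ⟨k1, hk1⟩
    have := gfield_adj hG hk1 hp
    simpa using this
  obtain ⟨k, hk, hkf⟩ := sa_range hC hl' f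
  have := h1 k hk
  rw [hkf] at this
  exact inner_self_eq_zero.1 this

lemma gfield_transport
    (h : invR (P : Set ((E × E) × (F × F))) = kreinAdj (P : Set ((E × E) × (F × F))))
    {R : ℂ → E →L[ℂ] E}
    (h1 : ∀ l : ℂ, l.im ≠ 0 → ∀ x,
      (R l x, x + l • R l x) ∈ closure (A0 (P : Set ((E × E) × (F × F)))))
    (hCl : IsLinRel (closure (A0 (P : Set ((E × E) × (F × F))))))
    {l m : ℂ} (hm : m.im ≠ 0) {p : F × E}
    (hp : p ∈ closure (gfield (P : Set ((E × E) × (F × F))) l)) :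
    (p.1, p.2 + (m - l) • R m p.2) ∈ closure (gfield (P : Set ((E × E) × (F × F))) m) := by
  let φ : F × E → F × E := fun p => (p.1, p.2 + (m - l) • R m p.2)
  have hφ : Continuous φ := by fun_prop
  suffices hs : ∀ p ∈ gfield (P : Set ((E × E) × (F × F))) l,
      φ p ∈ closure (gfield (P : Set ((E × E) × (F × F))) m) by
    have := map_mem_closure hφ hp hs
    rwa [closure_closure] at this
  rintro ⟨x, f⟩ ⟨x', hf⟩
  obtain ⟨Q, hQ⟩ := hCl
  have hk : (m - l) • (R m f, f + m • R m f) ∈ closure (A0 (P : Set ((E × E) × (F × F)))) := by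
    have := h1 m hm f
    rw [← hQ] at this ⊢
    exact Q.smul_mem _ this
  obtain ⟨a, b, ha, ha0, hak, hb, hb0, hab⟩ := correct h hm (p := ((f, l • f), (x, x'))) hk (by
    simp only [Prod.smul_fst, Prod.smul_snd]; module)
  refine mem_closure_iff_seq_limit.2
    ⟨fun n => (x - (b n).2.1, f + (a n).1.1 - (b n).1.1), fun n => ?_, ?_⟩
  · refine ⟨x' + (a n).2.2 - (b n).2.2, ?_⟩
    have h3 := P.sub_mem (P.add_mem hf (ha n)) (hb n)
    have h4 := hab n
    have h6 : x - (b n).2.1 = x + (a n).2.1 - (b n).2.1 := by rw [ha0, add_zero]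
    have h5 : ((f + (a n).1.1 - (b n).1.1, m • (f + (a n).1.1 - (b n).1.1)),
        (x - (b n).2.1, x' + (a n).2.2 - (b n).2.2)) = ((f, l • f), (x, x')) + a n - b n :=
      Prod.ext (Prod.ext rfl h4.symm) (Prod.ext h6 rfl)
    exact (congrArg (· ∈ P) h5).mpr h3
  · have c1 : Tendsto (fun n => (b n).2.1) atTop (𝓝 0) :=
      ((continuous_fst.comp continuous_snd).tendsto (0 : (E × E) × (F × F))).comp hb0
    have c2 : Tendsto (fun n => (b n).1.1) atTop (𝓝 0) :=
      ((continuous_fst.comp continuous_fst).tendsto (0 : (E × E) × (F × F))).comp hb0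
    have c3 : Tendsto (fun n => (a n).1.1) atTop (𝓝 ((m - l) • R m f)) :=
      (continuous_fst.tendsto _).comp hak
    have c4 := (c1.const_sub x).prodMk_nhds ((c3.const_add f).sub c2)
    simpa [φ] using c4

end Unitary

section Final

lemma closure_lin {M : Type*} [NormedAddCommGroup M] [NormedSpace ℂ M] {s : Set M}
    (h : IsLinRel s) : IsLinRel (closure s) := by
  obtain ⟨p, rfl⟩ := h
  exact ⟨p.topologicalClosure, rfl⟩

lemma preimage_lin {M N : Type*} [AddCommGroup M] [Module ℂ M] [AddCommGroup N] [Module ℂ N]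
    {s : Set N} (h : IsLinRel s) (L : M →ₗ[ℂ] N) : IsLinRel (L ⁻¹' s) := by
  obtain ⟨p, rfl⟩ := h
  exact ⟨p.comap L, rfl⟩

lemma gfield_lin (P : Submodule ℂ ((E × E) × (F × F))) (l : ℂ) :
    IsLinRel (gfield (P : Set ((E × E) × (F × F))) l) := by
  refine ⟨{ carrier := gfield (P : Set ((E × E) × (F × F))) l
            add_mem' := ?_, zero_mem' := ?_, smul_mem' := ?_ }, rfl⟩
  · rintro a b ⟨h1, hf⟩ ⟨h2, hg⟩
    refine ⟨h1 + h2, ?_⟩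
    have := P.add_mem hf hg
    simpa using this
  · exact ⟨0, by simp; exact P.zero_mem⟩
  · rintro c a ⟨h1, hf⟩
    refine ⟨c • h1, ?_⟩
    have := P.smul_mem c hf
    simpa [smul_comm c l] using this

lemma GMG_lin (P : Submodule ℂ ((E × E) × (F × F))) (G : F →L[ℂ] F) (l : ℂ) :
    IsLinRel (GMG (P : Set ((E × E) × (F × F))) G l) := by
  refine ⟨{ carrier := GMG (P : Set ((E × E) × (F × F))) G l
            add_mem' := ?_, zero_mem' := ?_, smul_mem' := ?_ }, rfl⟩
  · rintro a b ⟨h1, ⟨f, hf⟩, ha⟩ ⟨h2, ⟨g, hg⟩, hb⟩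
    refine ⟨h1 + h2, ⟨f + g, ?_⟩, ?_⟩
    · have := P.add_mem hf hg
      simpa using this
    · simp [ha, hb]
  · exact ⟨0, ⟨0, by simp; exact P.zero_mem⟩, by simp⟩
  · rintro c a ⟨h1, ⟨f, hf⟩, ha⟩
    refine ⟨c • h1, ⟨c • f, ?_⟩, ?_⟩
    · have := P.smul_mem c hf
      simpa [smul_comm c l] using this
    · simp [ha]

lemma Gtrans_lin (P : Submodule ℂ ((E × E) × (F × F))) (G : F →L[ℂ] F) :
    IsLinRel (Gtrans (P : Set ((E × E) × (F × F))) G) := by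
  refine ⟨{ carrier := Gtrans (P : Set ((E × E) × (F × F))) G
            add_mem' := ?_, zero_mem' := ?_, smul_mem' := ?_ }, rfl⟩
  · rintro a b ⟨h1, hf, ha⟩ ⟨h2, hg, hb⟩
    refine ⟨h1 + h2, ?_, ?_⟩
    · have := P.add_mem hf hg
      simpa using this
    · simp [ha, hb]
  · exact ⟨0, by simp; exact P.zero_mem, by simp⟩
  · rintro c a ⟨h1, hf, ha⟩
    refine ⟨c • h1, ?_, ?_⟩
    · have := P.smul_mem c hf
      simpa using this
    · simp [ha]

lemma Gtrans_green {Γ : Set ((E × E) × (F × F))} (hG : GreenPair Γ) (G : F →L[ℂ] F) :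
    GreenPair (Gtrans Γ G) := by
  rintro p ⟨h1, hp, hp2⟩ q ⟨h2, hq, hq2⟩
  have := hG _ hp _ hq
  simp only at this
  rw [this, hp2, hq2, ContinuousLinearMap.adjoint_inner_left,
    ContinuousLinearMap.adjoint_inner_right]

lemma green_closure {Γ : Set ((E × E) × (F × F))} (hG : GreenPair Γ) : GreenPair (closure Γ) := by
  have h1 : ∀ p ∈ closure Γ, ∀ q ∈ Γ,
    ⟪q.1.1, p.1.2⟫ - ⟪q.1.2, p.1.1⟫ = ⟪q.2.1, p.2.2⟫ - ⟪q.2.2, p.2.1⟫ := by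
    intro p hp q hq
    have hc : IsClosed {p : (E × E) × (F × F) |
        ⟪q.1.1, p.1.2⟫ - ⟪q.1.2, p.1.1⟫ = ⟪q.2.1, p.2.2⟫ - ⟪q.2.2, p.2.1⟫} :=
      isClosed_eq (by fun_prop) (by fun_prop)
    exact closure_minimal (fun p hp => hG p hp q hq) hc hp
  intro p hp q hq
  have hc : IsClosed {q : (E × E) × (F × F) |
      ⟪q.1.1, p.1.2⟫ - ⟪q.1.2, p.1.1⟫ = ⟪q.2.1, p.2.2⟫ - ⟪q.2.2, p.2.1⟫} :=
    isClosed_eq (by fun_prop) (by fun_prop)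
  exact closure_minimal (fun q hq => h1 p hp q hq) hc hq

end Final
/-- renormalization of an ES-generalized boundary triple to an
AB-generalized boundary pair whose Weyl function is `E + M₀` with `M₀ ∈ R[𝓗]`. -/
theorem statement17 (A : Set (E × E)) (Γ : Set ((E × E) × (F × F)))
    (hA : IsClosedSymRel A) (hU : IsUnitaryBT A Γ)
    (hEss : closure (A0 Γ) = adjR (A0 Γ)) :
    ∃ G : F →L[ℂ] F,
      (∀ u : F, G u = 0 → u = 0) ∧
      (∀ l : ℂ, l.im ≠ 0 → Set.range G = domR (closure (gfield Γ l))) ∧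
      -- (1)
      IsABPair A (closure (Gtrans Γ G)) ∧
      -- (2)
      (∃ e : Set (F × F), IsLinRel e ∧ IsClosed e ∧ Dense (domR e) ∧
        mulR e = {(0 : F)} ∧ e ⊆ adjR e ∧
        ∃ N : ℂ → F →L[ℂ] F, IsNevFun N ∧
          (∀ l : ℂ, l.im ≠ 0 →
            weyl (closure (Gtrans Γ G)) l =
              {p : F × F | ∃ w, (p.1, w) ∈ e ∧ p.2 = w + N l p.1}) ∧
          (∀ l m : ℂ, l.im ≠ 0 → m.im ≠ 0 →
            domR (weyl (closure (Gtrans Γ G)) l) = domR (weyl (closure (Gtrans Γ G)) m)) ∧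
          -- (3)
          (∃ e₀ : Set (F × F), e₀ ⊆ e ∧ IsLinRel e₀ ∧ IsClosed e₀ ∧ Dense (domR e₀) ∧
            mulR e₀ = {(0 : F)} ∧ e₀ ⊆ adjR e₀ ∧
            (∀ l : ℂ, l.im ≠ 0 →
              closure (GMG Γ G l) = {p : F × F | ∃ w, (p.1, w) ∈ e₀ ∧ p.2 = w + N l p.1}) ∧
            (∃ Γ'' : Set ((E × E) × (F × F)), IsABPair A Γ'' ∧ IsClosed Γ'' ∧
              ∀ l : ℂ, l.im ≠ 0 → weyl Γ'' l = closure (GMG Γ G l)))) := by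


  obtain ⟨⟨hG, hdom, hdd, hinv⟩, hm⟩ := hU
  obtain ⟨P, rfl⟩ := unitary_lin hinv
  obtain ⟨C, hCdef⟩ : ∃ C, C = closure (A0 (P : Set ((E × E) × (F × F)))) := ⟨_, rfl⟩
  have hC : C = adjR C := by
    conv_rhs => rw [hCdef, adjR_closure, ← hEss]
    exact hCdef
  have hC' : closure (A0 (P : Set ((E × E) × (F × F)))) =
      adjR (closure (A0 (P : Set ((E × E) × (F × F))))) := by rw [← hCdef]; exact hC
  have hCl : IsLinRel C := by rw [hC]; exact adjR_lin C
  have hCcl : IsClosed C := by rw [hC]; exact adjR_closed C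
  obtain ⟨R, h1, h2⟩ := exists_resolvent hC
  have h1' := h1
  rw [hCdef] at h1'
  have hCl' := hCl
  rw [hCdef] at hCl'
  have hI : Complex.I.im ≠ 0 := by simp
  -- the parametrization of the closed gamma field
  obtain ⟨X, hX⟩ := closure_lin (gfield_lin P Complex.I)
  obtain ⟨G, B, hGi, hXp, hbd⟩ := exists_param X (by rw [hX]; exact isClosed_closure)
    (fun f hf => gfield_sv hG hC' hI (by rw [← hX]; exact hf))
    ((dense_dom hinv hG hm hI).mono (by
      rintro x ⟨f, hf⟩
      refine ⟨f, ?_⟩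
      show (x, f) ∈ (X : Set (F × E))
      rw [hX]; exact subset_closure hf))
  have hXI : ∀ p, p ∈ closure (gfield (P : Set ((E × E) × (F × F))) Complex.I) ↔
      ∃ u, p = (G u, B u) := by
    intro p; rw [← hX]; exact hXp p
  have hGinj : ∀ u v, G u = G v → u = v := by
    intro u v huv
    rw [← sub_eq_zero]
    apply hGi
    rw [map_sub, huv, sub_self]
  obtain ⟨Bl, hBl⟩ : ∃ Bl : ℂ → F →L[ℂ] E, ∀ l u, Bl l u = B u + (l - Complex.I) • R l (B u) :=
    ⟨fun l => B + (l - Complex.I) • (R l).comp B, fun l u => rfl⟩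
  have hB1 : ∀ l : ℂ, l.im ≠ 0 → ∀ u,
      (G u, Bl l u) ∈ closure (gfield (P : Set ((E × E) × (F × F))) l) := by
    intro l hl u
    have := gfield_transport hinv h1' hCl' hl ((hXI _).2 ⟨u, rfl⟩)
    rw [hBl]; exact this
  have hB2 : ∀ l : ℂ, l.im ≠ 0 → ∀ p ∈ closure (gfield (P : Set ((E × E) × (F × F))) l),
      ∃ u, p = (G u, Bl l u) := by
    intro l hl p hp
    obtain ⟨u, hu⟩ := (hXI _).1 (gfield_transport hinv h1' hCl' hI hp)
    have hu1 : p.1 = G u := congrArg Prod.fst hu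
    refine ⟨u, Prod.ext hu1 ?_⟩
    obtain ⟨Y, hY⟩ := closure_lin (gfield_lin P l)
    have h3 := hB1 l hl u
    have h4 : p - (G u, Bl l u) ∈ closure (gfield (P : Set ((E × E) × (F × F))) l) := by
      rw [← hY] at hp h3 ⊢
      exact Y.sub_mem hp h3
    have h5 : p - (G u, Bl l u) = (0, p.2 - Bl l u) :=
      Prod.ext (by simp [hu1]) rfl
    rw [h5] at h4
    exact sub_eq_zero.1 (gfield_sv hG hC' hl h4)
  have hB3 : ∀ l : ℂ, l.im ≠ 0 → ∀ u,
      B u = Bl l u + (Complex.I - l) • R Complex.I (Bl l u) := by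
    intro l hl u
    obtain ⟨v, hv⟩ := (hXI _).1 (gfield_transport hinv h1' hCl' hI (hB1 l hl u))
    have hv1 : G u = G v := congrArg Prod.fst hv
    have hv2 : Bl l u + (Complex.I - l) • R Complex.I (Bl l u) = B v := congrArg Prod.snd hv
    rw [hv2, hGinj _ _ hv1]
  have hBI : ∀ u, Bl Complex.I u = B u := by intro u; rw [hBl]; simp
  have hconv : ∀ (v : ℕ → F) (u : F), Tendsto (fun n => G (v n)) atTop (𝓝 (G u)) →
      Tendsto (fun n => B (v n)) atTop (𝓝 (B u)) → Tendsto v atTop (𝓝 u) := by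
    intro v u hv1 hv2
    rw [tendsto_iff_norm_sub_tendsto_zero] at hv1 hv2 ⊢
    have := hv1.add hv2
    rw [add_zero] at this
    refine squeeze_zero (fun n => norm_nonneg _) (fun n => ?_) this
    have := hbd (v n - u)
    rwa [map_sub, map_sub] at this
  have hk1 : ∀ (k : E × E) (k1 : F), (k, ((0 : F), k1)) ∈ P →
      ContinuousLinearMap.adjoint G k1 =
        ContinuousLinearMap.adjoint B (k.2 + Complex.I • k.1) := by
    intro k k1 hk
    apply ext_inner_right ℂ
    intro u
    rw [ContinuousLinearMap.adjoint_inner_left, ContinuousLinearMap.adjoint_inner_left]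
    have := gfield_adj hG hk ((hXI _).2 ⟨u, rfl⟩)
    simp only [Complex.conj_I, neg_smul, sub_neg_eq_add] at this
    exact this.symm
  -- the closure of the transformed triple
  obtain ⟨T, hTdef⟩ : ∃ T, T = closure (Gtrans (P : Set ((E × E) × (F × F))) G) := ⟨_, rfl⟩
  have hTl : IsLinRel T := by rw [hTdef]; exact closure_lin (Gtrans_lin P G)
  have hTc : IsClosed T := by rw [hTdef]; exact isClosed_closure
  have hTg : GreenPair T := by rw [hTdef]; exact green_closure (Gtrans_green hG G)
  have hCT : ∀ k ∈ C, (k, ((0 : F), ContinuousLinearMap.adjoint B (k.2 + Complex.I • k.1))) ∈ T := by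
    intro k hk
    let φ : E × E → (E × E) × (F × F) :=
      fun k => (k, ((0 : F), ContinuousLinearMap.adjoint B (k.2 + Complex.I • k.1)))
    have hφ : Continuous φ := by fun_prop
    rw [hCdef] at hk
    rw [hTdef]
    show φ k ∈ closure (Gtrans (P : Set ((E × E) × (F × F))) G)
    refine map_mem_closure hφ hk ?_
    rintro k ⟨k1, hk⟩
    refine ⟨k1, ?_, (hk1 k k1 hk).symm⟩
    show (k, (G 0, k1)) ∈ P
    rw [map_zero]; exact hk
  have hfB : ∀ (f : E) (u u' : F), ((f, Complex.I • f), (u, u')) ∈ T → f = B u := by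
    intro f u u' hf
    apply ext_inner_left ℂ
    intro x
    obtain ⟨k, hk, hkx⟩ := sa_range hC (l := -Complex.I) (by simp) x
    rw [neg_smul, sub_neg_eq_add] at hkx
    have := hTg _ hf _ (hCT k hk)
    simp only at this
    rw [hkx, ContinuousLinearMap.adjoint_inner_left, inner_zero_left, inner_smul_right] at this
    have h3 : ⟪x, f⟫ = ⟪k.2, f⟫ - Complex.I * ⟪k.1, f⟫ := by
      rw [← hkx, inner_add_left, inner_smul_left, Complex.conj_I]; ring
    rw [h3]
    linear_combination -this
  let Le : F × F →L[ℂ] (E × E) × (F × F) :=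
    ((B.comp (ContinuousLinearMap.fst ℂ F F)).prod
      (Complex.I • (B.comp (ContinuousLinearMap.fst ℂ F F)))).prod
    ((ContinuousLinearMap.fst ℂ F F).prod (ContinuousLinearMap.snd ℂ F F +
      (ContinuousLinearMap.adjoint B).comp (Complex.I • (B.comp (ContinuousLinearMap.fst ℂ F F)))))
  have hLe : ∀ p, Le p = ((B p.1, Complex.I • B p.1),
      (p.1, p.2 + ContinuousLinearMap.adjoint B (Complex.I • B p.1))) := fun p => rfl
  let Ls : F × F →L[ℂ] F × F :=
    (ContinuousLinearMap.fst ℂ F F).prod (ContinuousLinearMap.snd ℂ F F +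
      (ContinuousLinearMap.adjoint B).comp (Complex.I • (B.comp (ContinuousLinearMap.fst ℂ F F))))
  have hLs : ∀ p, Ls p = (p.1, p.2 + ContinuousLinearMap.adjoint B (Complex.I • B p.1)) :=
    fun p => rfl
  obtain ⟨e, he⟩ : ∃ e : Set (F × F), e = Le ⁻¹' T := ⟨_, rfl⟩
  obtain ⟨e0, he0⟩ : ∃ e : Set (F × F),
    e = Ls ⁻¹' closure (GMG (P : Set ((E × E) × (F × F))) G Complex.I) := ⟨_, rfl⟩
  have hel : IsLinRel e := by rw [he]; exact preimage_lin hTl (Le : F × F →ₗ[ℂ] _)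
  have hec : IsClosed e := by rw [he]; exact hTc.preimage Le.continuous
  have he0l : IsLinRel e0 := by
    rw [he0]; exact preimage_lin (closure_lin (GMG_lin P G _)) (Ls : F × F →ₗ[ℂ] _)
  have he0c : IsClosed e0 := by rw [he0]; exact isClosed_closure.preimage Ls.continuous
  have hGB : ∀ l : ℂ, l.im ≠ 0 → ∀ (f : E) (u h' : F), ((f, l • f), (G u, h')) ∈ P →
      f = Bl l u := by
    intro l hl f u h' hf
    obtain ⟨v, hv⟩ := hB2 l hl (G u, f) (subset_closure ⟨h', hf⟩)
    have hv1 : G u = G v := congrArg Prod.fst hv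
    have hv2 : f = Bl l v := congrArg Prod.snd hv
    rw [hv2, hGinj _ _ hv1]
  have hGran : ∀ l : ℂ, l.im ≠ 0 → ∀ (f : E) (x h' : F), ((f, l • f), (x, h')) ∈ P →
      ∃ u, x = G u ∧ f = Bl l u := by
    intro l hl f x h' hf
    obtain ⟨v, hv⟩ := hB2 l hl (x, f) (subset_closure ⟨h', hf⟩)
    exact ⟨v, congrArg Prod.fst hv, congrArg Prod.snd hv⟩
  have hee : e0 ⊆ e := by
    intro p hp
    rw [he0] at hp
    rw [he]
    show Le p ∈ T
    have hc : Continuous (fun p : F × F => (((B p.1, Complex.I • B p.1), p) : (E × E) × (F × F))) := by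
      fun_prop
    have := map_mem_closure (t := T) hc hp (by
      rintro ⟨u, v⟩ ⟨h', ⟨f, hf⟩, hv⟩
      have hfe := hGB _ hI _ _ _ hf
      rw [hBI] at hfe
      rw [hTdef]
      apply subset_closure
      refine ⟨h', ?_, hv⟩
      show ((B u, Complex.I • B u), (G u, h')) ∈ P
      rw [← hfe]; exact hf)
    rw [hTc.closure_eq] at this
    exact this
  have hdomGMG : ∀ (u v : F), (u, v) ∈ GMG (P : Set ((E × E) × (F × F))) G Complex.I →
      u ∈ domR e0 := by
    intro u v huv
    refine ⟨v - ContinuousLinearMap.adjoint B (Complex.I • B u), ?_⟩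
    rw [he0]
    show Ls (u, v - ContinuousLinearMap.adjoint B (Complex.I • B u)) ∈
      closure (GMG (P : Set ((E × E) × (F × F))) G Complex.I)
    rw [hLs]
    simp only [sub_add_cancel]
    exact subset_closure huv
  have hde0 : Dense (domR e0) := by
    intro u
    obtain ⟨s, hs, hsl⟩ := mem_closure_iff_seq_limit.1 ((hXI _).2 ⟨u, rfl⟩)
    have hs' : ∀ n, ∃ v, s n = (G v, B v) := fun n => (hXI _).1 (subset_closure (hs n))
    choose v hv using hs'
    refine mem_closure_iff_seq_limit.2 ⟨v, fun n => ?_, ?_⟩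
    · obtain ⟨h', hf⟩ := hs n
      rw [hv n] at hf
      exact hdomGMG _ (ContinuousLinearMap.adjoint G h') ⟨h', ⟨_, hf⟩, rfl⟩
    · apply hconv
      · have := (continuous_fst.tendsto _).comp hsl
        refine this.congr fun n => ?_
        simp [hv n]
      · have := (continuous_snd.tendsto _).comp hsl
        refine this.congr fun n => ?_
        simp [hv n]
  have hde : Dense (domR e) := hde0.mono (by
    rintro u ⟨v, hv⟩; exact ⟨v, hee hv⟩)
  have hmul : ∀ w, ((0 : F), w) ∈ e → w = 0 := by
    intro w hw
    rw [he] at hw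
    change Le _ ∈ T at hw
    rw [hLe] at hw
    simp only [map_zero, smul_zero, add_zero] at hw
    have h3 : ∀ v ∈ domR e, ⟪v, w⟫ = 0 := by
      rintro v ⟨v', hv⟩
      rw [he] at hv
      have := hTg _ hw _ hv
      rw [hLe] at this
      simp only [inner_zero_right, sub_zero] at this
      exact this.symm
    have hc : IsClosed {v : F | ⟪v, w⟫ = 0} := isClosed_eq (by fun_prop) (by fun_prop)
    have h4 : ⟪w, w⟫ = 0 := closure_minimal h3 hc (hde w)
    exact inner_self_eq_zero.1 h4
  have hsym : ∀ p ∈ e, ∀ q ∈ e, ⟪p.1, q.2⟫ = ⟪p.2, q.1⟫ := by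
    intro p hp q hq
    rw [he] at hp hq
    have := hTg _ hq _ hp
    rw [hLe, hLe] at this
    simp only [inner_add_left, inner_add_right, inner_smul_left, inner_smul_right,
      ContinuousLinearMap.adjoint_inner_left, ContinuousLinearMap.adjoint_inner_right,
      Complex.conj_I] at this
    linear_combination -this
  have hzero : ∀ {s : Set (F × F)}, IsLinRel s → (0 : F × F) ∈ s := by
    rintro s ⟨p, rfl⟩; exact p.zero_mem
  have hTP : T = Prel C B e := by
    obtain ⟨Q, hQ⟩ := hTl
    apply Set.Subset.antisymm
    · rintro ⟨⟨f, f'⟩, ⟨u, u'⟩⟩ hq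
      obtain ⟨k, hk, hkx⟩ := sa_range hC hI (f' - Complex.I • f)
      have h3 := hCT k hk
      have h4 : ((f - k.1, Complex.I • (f - k.1)),
          (u, u' - ContinuousLinearMap.adjoint B (k.2 + Complex.I • k.1))) ∈ T := by
        have h5 : (((f, f'), (u, u')) : (E × E) × (F × F)) -
            (k, ((0 : F), ContinuousLinearMap.adjoint B (k.2 + Complex.I • k.1))) ∈ T := by
          rw [← hQ] at hq h3 ⊢
          exact Q.sub_mem hq h3
        convert h5 using 1
        refine Prod.ext (Prod.ext rfl ?_) (Prod.ext ?_ rfl)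
        · show Complex.I • (f - k.1) = f' - k.2
          rw [smul_sub]
          rw [sub_eq_sub_iff_add_eq_add] at hkx ⊢
          rw [add_comm, hkx, add_comm]
        · simp
      have h6 := hfB _ _ _ h4
      refine ⟨k, hk, (u, u' - ContinuousLinearMap.adjoint B (k.2 + Complex.I • k.1)
        - ContinuousLinearMap.adjoint B (Complex.I • B u)), ?_, ?_⟩
      · rw [he]
        show Le _ ∈ T
        rw [hLe]
        simp only [sub_add_cancel]
        rw [← h6]; exact h4
      · simp only [← h6, Prod.mk.injEq, map_add, true_and]
        refine ⟨⟨by abel, ?_⟩, by abel⟩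
        rw [smul_sub, add_sub, eq_sub_iff_add_eq]
        rw [sub_eq_sub_iff_add_eq_add] at hkx
        exact hkx.symm
    · rintro _ ⟨k, hk, p, hp, rfl⟩
      have h3 := hCT k hk
      rw [he] at hp
      change Le p ∈ T at hp
      rw [hLe] at hp
      rw [← hQ] at h3 hp ⊢
      have := Q.add_mem h3 hp
      have h5 : (((k.1 + B p.1, k.2 + Complex.I • B p.1), (p.1, p.2 +
          ContinuousLinearMap.adjoint B (Complex.I • B p.1 + (k.2 + Complex.I • k.1)))) :
            (E × E) × (F × F)) =
          (k, ((0 : F), ContinuousLinearMap.adjoint B (k.2 + Complex.I • k.1))) +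
          ((B p.1, Complex.I • B p.1),
            (p.1, p.2 + ContinuousLinearMap.adjoint B (Complex.I • B p.1))) := by
        refine Prod.ext (Prod.ext rfl rfl) (Prod.ext (zero_add _).symm ?_)
        show p.2 + ContinuousLinearMap.adjoint B (Complex.I • B p.1 + (k.2 + Complex.I • k.1)) =
          ContinuousLinearMap.adjoint B (k.2 + Complex.I • k.1) +
            (p.2 + ContinuousLinearMap.adjoint B (Complex.I • B p.1))
        rw [map_add]; abel
      rw [h5]; exact this
  have hTdom : domR T ⊆ adjR A := by
    rintro f ⟨h, hf⟩
    rw [hTdef] at hf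
    have := map_mem_closure (t := domR (P : Set ((E × E) × (F × F)))) continuous_fst hf (by
      rintro q ⟨h', hq, -⟩
      exact ⟨_, hq⟩)
    rw [hdd] at this
    exact this
  have hDD : adjR A ⊆ closure (domR (Prel C B e0)) := by
    rw [← hdd]
    refine closure_minimal ?_ isClosed_closure
    rintro f ⟨x, hf⟩
    obtain ⟨k, hk, hkx⟩ := sa_range hC hI (-(f.2 - Complex.I • f.1))
    have hk' := hk
    rw [hCdef] at hk'
    obtain ⟨a, b, ha, ha0, hak, hb, hb0, hab⟩ := correct hinv hI (p := (f, x)) hk' (by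
      show f.2 + k.2 = Complex.I • (f.1 + k.1)
      have : k.2 = -(f.2 - Complex.I • f.1) + Complex.I • k.1 := by rw [← hkx]; abel
      rw [this]; module)
    refine mem_closure_iff_seq_limit.2 ⟨fun n => f - (b n).1, fun n => ?_, ?_⟩
    · have h3 := P.sub_mem (P.add_mem hf (ha n)) (hb n)
      have h4 := hab n
      generalize hc : (f, x) + a n - b n = c at h3 h4
      obtain ⟨⟨c1, c2⟩, ⟨c3, c4⟩⟩ := c
      simp only at h4
      subst h4
      obtain ⟨u, hu, hu2⟩ := hGran _ hI _ _ _ h3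
      rw [hBI] at hu2
      subst hu
      obtain ⟨w, hw⟩ := hdomGMG u (ContinuousLinearMap.adjoint G c4) ⟨c4, ⟨_, h3⟩, rfl⟩
      have hanC : -(a n).1 ∈ C := by
        obtain ⟨Q, hQ⟩ := hCl
        have : (a n).1 ∈ C := by
          rw [hCdef]
          apply subset_closure
          refine ⟨(a n).2.2, ?_⟩
          have h5 := ha n
          have h6 : a n = ((a n).1, ((0 : F), (a n).2.2)) := 
            Prod.ext rfl (Prod.ext (ha0 n) rfl)
          rw [h6] at h5
          exact h5
        rw [← hQ] at this ⊢
        exact Q.neg_mem this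
      refine ⟨_, -(a n).1, hanC, (u, w), hw, Prod.ext ?_ rfl⟩
      have h7 : f + (a n).1 - (b n).1 = (c1, Complex.I • c1) := congrArg Prod.fst hc
      show f - (b n).1 = -(a n).1 + (B u, Complex.I • B u)
      rw [← hu2, ← h7]; abel
    · have c1 : Tendsto (fun n => (b n).1) atTop (𝓝 0) :=
        (continuous_fst.tendsto (0 : (E × E) × (F × F))).comp hb0
      have := c1.const_sub f
      simpa using this
  have hmono : ∀ {s t : Set (F × F)}, s ⊆ t → Prel C B s ⊆ Prel C B t := by
    rintro s t hst _ ⟨k, hk, p, hp, rfl⟩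
    exact ⟨k, hk, p, hst hp, rfl⟩
  have hAB : ∀ s : Set (F × F), e0 ⊆ s → s ⊆ e → IsLinRel s → IsABPair A (Prel C B s) := by
    intro s hs1 hs2 hs3
    have hsub : Prel C B s ⊆ T := by rw [hTP]; exact hmono hs2
    have hd1 : domR (Prel C B s) ⊆ adjR A := by
      rintro f ⟨h, hf⟩; exact hTdom ⟨h, hsub hf⟩
    refine ⟨⟨Prel_lin hCl B hs3, hd1, fun p hp q hq => hTg p (hsub hp) q (hsub hq)⟩, ?_, ?_, ?_⟩
    · apply Set.Subset.antisymm
      · exact closure_minimal hd1 (adjR_closed A)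
      · refine hDD.trans (closure_mono ?_)
        rintro f ⟨h, hf⟩; exact ⟨h, hmono hs1 hf⟩
    · refine hde0.mono ?_
      rintro u ⟨w, hw⟩
      have hC0 : (0 : E × E) ∈ C := by
        obtain ⟨Q, hQ⟩ := hCl
        rw [← hQ]; exact Q.zero_mem
      exact ⟨_, _, 0, hC0, (u, w), hs1 hw, rfl⟩
    · rw [Prel_A0 B (hzero hs3)]; exact hC
  have hweyl : ∀ l : ℂ, l.im ≠ 0 → weyl T l =
      {p : F × F | ∃ w, (p.1, w) ∈ e ∧ p.2 = w + Npar R B l p.1} := by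
    intro l hl
    rw [hTP]; exact Prel_weyl hCl h1 h2 B e hl
  have htrans : ∀ l m : ℂ, l.im ≠ 0 → m.im ≠ 0 →
      ∀ p ∈ closure (GMG (P : Set ((E × E) × (F × F))) G l),
      (p.1, p.2 + (Npar R B m p.1 - Npar R B l p.1)) ∈
        closure (GMG (P : Set ((E × E) × (F × F))) G m) := by
    intro l m hl hm' p hp
    let φ : F × F → F × F := fun p => (p.1, p.2 + (Npar R B m p.1 - Npar R B l p.1))
    have hφ : Continuous φ := by fun_prop
    suffices hs : ∀ p ∈ GMG (P : Set ((E × E) × (F × F))) G l,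
        φ p ∈ closure (GMG (P : Set ((E × E) × (F × F))) G m) by
      have := map_mem_closure hφ hp hs
      rwa [closure_closure] at this
    rintro ⟨u, v⟩ ⟨h', ⟨f, hf⟩, hv⟩
    simp only at hf hv
    have hfB := hGB l hl _ _ _ hf
    have hk : (m - l) • (R m f, f + m • R m f) ∈ C := by
      obtain ⟨Q, hQ⟩ := hCl
      have := h1 m hm' f
      rw [← hQ] at this ⊢
      exact Q.smul_mem _ this
    rw [hCdef] at hk
    obtain ⟨a, b, ha, ha0, hak, hb, hb0, hab⟩ := correct hinv hm' (p := ((f, l • f), (G u, h'))) hk (by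
      simp only [Prod.smul_fst, Prod.smul_snd]; module)
    have hfm : f + (m - l) • R m f = Bl m u := by
      obtain ⟨v, hv⟩ := hB2 m hm' _ (gfield_transport hinv h1' hCl' hm' (hB1 l hl u))
      have hv1 : G u = G v := congrArg Prod.fst hv
      have hv2 : Bl l u + (m - l) • R m (Bl l u) = Bl m v := congrArg Prod.snd hv
      rw [hfB, hv2, hGinj _ _ hv1]
    have hex : ∀ n, ∃ w, G w = G u - (b n).2.1 ∧ Bl m w = f + (a n).1.1 - (b n).1.1 ∧
        (w, v + ContinuousLinearMap.adjoint B ((a n).1.2 + Complex.I • (a n).1.1)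
          - ContinuousLinearMap.adjoint G (b n).2.2) ∈ GMG (P : Set ((E × E) × (F × F))) G m := by
      intro n
      have h3 := P.sub_mem (P.add_mem hf (ha n)) (hb n)
      have h4 := hab n
      have h6 : G u - (b n).2.1 = G u + (a n).2.1 - (b n).2.1 := by rw [ha0, add_zero]
      have h5 : ((f + (a n).1.1 - (b n).1.1, m • (f + (a n).1.1 - (b n).1.1)),
          (G u - (b n).2.1, h' + (a n).2.2 - (b n).2.2)) = ((f, l • f), (G u, h')) + a n - b n :=
        Prod.ext (Prod.ext rfl h4.symm) (Prod.ext h6 rfl)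
      have h7 := (congrArg (· ∈ P) h5).mpr h3
      obtain ⟨w, hw1, hw2⟩ := hGran m hm' _ _ _ h7
      refine ⟨w, hw1.symm, hw2.symm, h' + (a n).2.2 - (b n).2.2,
        ⟨f + (a n).1.1 - (b n).1.1, ?_⟩, ?_⟩
      · rw [← hw1]; exact h7
      · have h8 : a n = ((a n).1, ((0 : F), (a n).2.2)) := Prod.ext rfl (Prod.ext (ha0 n) rfl)
        have h9 := ha n
        rw [h8] at h9
        show v + _ - _ = _
        rw [← hk1 _ _ h9, hv, map_sub, map_add]
    choose w hw1 hw2 hw3 using hex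
    have c1 : Tendsto (fun n => (b n).2.1) atTop (𝓝 0) :=
      ((continuous_fst.comp continuous_snd).tendsto (0 : (E × E) × (F × F))).comp hb0
    have c2 : Tendsto (fun n => (b n).1.1) atTop (𝓝 0) :=
      ((continuous_fst.comp continuous_fst).tendsto (0 : (E × E) × (F × F))).comp hb0
    have c5 : Tendsto (fun n => (b n).2.2) atTop (𝓝 0) :=
      ((continuous_snd.comp continuous_snd).tendsto (0 : (E × E) × (F × F))).comp hb0
    have c3 : Tendsto (fun n => (a n).1.1) atTop (𝓝 ((m - l) • R m f)) :=
      (continuous_fst.tendsto _).comp hak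
    have c4 : Tendsto (fun n => (a n).1.2) atTop (𝓝 ((m - l) • (f + m • R m f))) :=
      (continuous_snd.tendsto _).comp hak
    have d1 : Tendsto (fun n => G (w n)) atTop (𝓝 (G u)) := by
      simp only [hw1]
      have := c1.const_sub (G u)
      rwa [sub_zero] at this
    have d2 : Tendsto (fun n => Bl m (w n)) atTop (𝓝 (Bl m u)) := by
      simp only [hw2, ← hfm]
      have := (c3.const_add f).sub c2
      rwa [sub_zero] at this
    have d3 : Tendsto (fun n => B (w n)) atTop (𝓝 (B u)) := by
      rw [hB3 m hm' u]
      have hc : Continuous (fun x : E => x + (Complex.I - m) • R Complex.I x) := by fun_prop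
      have := (hc.tendsto (Bl m u)).comp d2
      refine this.congr fun n => ?_
      exact (hB3 m hm' (w n)).symm
    have d4 := hconv w u d1 d3
    refine mem_closure_iff_seq_limit.2 ⟨_, hw3, d4.prodMk_nhds ?_⟩
    have d5 : Tendsto (fun n => v + ContinuousLinearMap.adjoint B ((a n).1.2 + Complex.I • (a n).1.1)
          - ContinuousLinearMap.adjoint G (b n).2.2) atTop
        (𝓝 (v + ContinuousLinearMap.adjoint B ((m - l) • (f + m • R m f) +
          Complex.I • ((m - l) • R m f)) - ContinuousLinearMap.adjoint G 0)) := by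
      refine Tendsto.sub (Tendsto.const_add _ ?_) ?_
      · exact ((ContinuousLinearMap.adjoint B).continuous.tendsto _).comp (c4.add (c3.const_smul _))
      · exact ((ContinuousLinearMap.adjoint G).continuous.tendsto _).comp c5
    convert d5 using 2
    simp only [Npar_apply]
    rw [map_zero, sub_zero, ← map_sub]
    congr 2
    rw [hfB, hBl]
    have hri := resolvent_identity hC h1 h2 hl hm' (B u)
    simp only [map_add, map_smul]
    generalize R m (R l (B u)) = z at hri ⊢
    generalize R l (B u) = y at hri ⊢
    have hri' : R m (B u) = (m - l) • z + y := by rw [hri]; abel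
    rw [hri']
    match_scalars
    · ring
    · linear_combination (m - l) * Complex.I_sq
    · ring
  have hNI : ∀ u, Npar R B Complex.I u = ContinuousLinearMap.adjoint B (Complex.I • B u) := by
    intro u
    rw [Npar_apply, Complex.I_sq, neg_add_cancel, zero_smul, add_zero]
  have hme0 : ∀ u w, (u, w) ∈ e0 ↔ (u, w + Npar R B Complex.I u) ∈
      closure (GMG (P : Set ((E × E) × (F × F))) G Complex.I) := by
    intro u w
    rw [he0, Set.mem_preimage, hLs, hNI]
  have hclos : ∀ l : ℂ, l.im ≠ 0 → closure (GMG (P : Set ((E × E) × (F × F))) G l) =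
      {p : F × F | ∃ w, (p.1, w) ∈ e0 ∧ p.2 = w + Npar R B l p.1} := by
    intro l hl
    ext ⟨u, v⟩
    constructor
    · intro hp
      refine ⟨v - Npar R B l u, ?_, (sub_add_cancel _ _).symm⟩
      rw [hme0]
      have h3 := htrans l Complex.I hl hI _ hp
      have h4 : v - Npar R B l u + Npar R B Complex.I u =
        v + (Npar R B Complex.I u - Npar R B l u) := by abel
      show (u, v - Npar R B l u + Npar R B Complex.I u) ∈ _
      rw [h4]; exact h3
    · rintro ⟨w, hw, hv⟩
      simp only at hw hv
      rw [hme0] at hw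
      have h3 := htrans Complex.I l hI hl _ hw
      have h4 : v = w + Npar R B Complex.I u + (Npar R B l u - Npar R B Complex.I u) := by
        rw [hv]; abel
      rw [h4]; exact h3
  refine ⟨G, hGi, ?_, ?_, e, hel, hec, hde, ?_, fun p hp q hq => hsym p hp q hq,
    Npar R B, Npar_nev hC h1 h2 B, ?_, ?_, e0, hee, he0l, he0c, hde0, ?_,
    fun p hp q hq => hsym p (hee hp) q (hee hq), ?_, Prel C B e0, hAB e0 subset_rfl hee he0l,
    Prel_closed hCcl B he0c, ?_⟩
  · intro l hl
    ext x
    constructor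
    · rintro ⟨u, rfl⟩
      exact ⟨_, hB1 l hl u⟩
    · rintro ⟨f, hf⟩
      obtain ⟨u, hu⟩ := hB2 l hl _ hf
      exact ⟨u, (congrArg Prod.fst hu).symm⟩
  · rw [← hTdef, hTP]
    exact hAB e hee subset_rfl hel
  · ext w
    exact ⟨fun hw => hmul w hw, fun hw => by rw [hw]; exact hzero hel⟩
  · rw [← hTdef]; exact hweyl
  · intro l m hl hm'
    rw [← hTdef, hweyl l hl, hweyl m hm']
    ext u
    constructor
    · rintro ⟨v, w, hw, -⟩
      exact ⟨w + Npar R B m u, w, hw, rfl⟩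
    · rintro ⟨v, w, hw, -⟩
      exact ⟨w + Npar R B l u, w, hw, rfl⟩
  · ext w
    exact ⟨fun hw => hmul w (hee hw), fun hw => by rw [hw]; exact hzero he0l⟩
  · exact hclos
  · intro l hl
    rw [Prel_weyl hCl h1 h2 B e0 hl, hclos l hl]

end BT
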